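/- arXiv:1511.07296 — 5 statements merged into one kernel-verified Lean document; each statement's English description precedes it below -/
import Mathlib

section
/- Let A be a 4-dimensional non-split non-Lie nilpotent Leibniz algebra over ℂ with dim A² = 1. Then A is isomorphic to the Leibniz algebra with basis {x1,x2,x3,x4} whose nonzero products are given by one of the following: (A1) [x1,x3]=x4, [x3,x2]=x4; (A2) [x1,x3]=x4, [x2,x2]=x4, [x2,x3]=x4, [x3,x1]=x4, [x3,x2]=−x4; (A3) [x1,x2]=x4, [x2,x1]=−x4, [x3,x3]=x4; (A4) [x1,x2]=x4, [x2,x1]=−x4, [x2,x2]=x4, [x3,x3]=x4; (A5) [x1,x2]=x4, [x2,x1]=c·x4, [x3,x3]=x4 for some c ∈ ℂ\{1,−1}; (A6) [x1,x1]=x4, [x2,x2]=x4, [x3,x3]=x4. -/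
noncomputable section

/-- The span of all brackets `[a, b]` with `a ∈ A`, `b ∈ S`. -/
def bracketSpan {A : Type*} [AddCommGroup A] [Module ℂ A]
    (β : A →ₗ[ℂ] A →ₗ[ℂ] A) (S : Submodule ℂ A) : Submodule ℂ A :=
  Submodule.span ℂ {x | ∃ a : A, ∃ b ∈ S, x = β a b}

/-- `lpow β i` is `Aⁱ`: `A¹ = A` and `Aⁱ = [A, Aⁱ⁻¹]` for `i ≥ 2`
(with the convention `lpow β 0 = ⊤`). -/
def lpow {A : Type*} [AddCommGroup A] [Module ℂ A]
    (β : A →ₗ[ℂ] A →ₗ[ℂ] A) : ℕ → Submodule ℂ A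
  | 0 => ⊤
  | 1 => ⊤
  | n + 2 => bracketSpan β (lpow β (n + 1))

/-- `Leib(A)`, the span of all squares `[a, a]`. -/
def leibSpan {A : Type*} [AddCommGroup A] [Module ℂ A]
    (β : A →ₗ[ℂ] A →ₗ[ℂ] A) : Submodule ℂ A :=
  Submodule.span ℂ {x | ∃ a : A, x = β a a}

/-- The (left) Leibniz identity. -/
def IsLeibniz {A : Type*} [AddCommGroup A] [Module ℂ A]
    (β : A →ₗ[ℂ] A →ₗ[ℂ] A) : Prop :=
  ∀ a b c : A, β a (β b c) = β (β a b) c + β b (β a c)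

/-- Nilpotency: some term of the lower central series vanishes. -/
def LeibNilpotent {A : Type*} [AddCommGroup A] [Module ℂ A]
    (β : A →ₗ[ℂ] A →ₗ[ℂ] A) : Prop :=
  ∃ n : ℕ, lpow β n = ⊥

/-- The center `Z(A)` as a set. -/
def centerSet {A : Type*} [AddCommGroup A] [Module ℂ A]
    (β : A →ₗ[ℂ] A →ₗ[ℂ] A) : Set A :=
  {x | ∀ a : A, β x a = 0 ∧ β a x = 0}

/-- Two-sided ideal. -/
def LeibIsIdeal {A : Type*} [AddCommGroup A] [Module ℂ A]
    (β : A →ₗ[ℂ] A →ₗ[ℂ] A) (I : Submodule ℂ A) : Prop :=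
  ∀ x ∈ I, ∀ a : A, β x a ∈ I ∧ β a x ∈ I

/-- `A` is split if it is the (internal) direct sum of two nonzero two-sided ideals. -/
def LeibIsSplit {A : Type*} [AddCommGroup A] [Module ℂ A]
    (β : A →ₗ[ℂ] A →ₗ[ℂ] A) : Prop :=
  ∃ I J : Submodule ℂ A, LeibIsIdeal β I ∧ LeibIsIdeal β J ∧
    I ≠ ⊥ ∧ J ≠ ⊥ ∧ I ⊓ J = ⊥ ∧ I ⊔ J = ⊤

/-- Isomorphism of Leibniz algebras: a linear bijection preserving the bracket. -/
def LeibIso {A : Type*} [AddCommGroup A] [Module ℂ A]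
    {B : Type*} [AddCommGroup B] [Module ℂ B]
    (β : A →ₗ[ℂ] A →ₗ[ℂ] A) (γ : B →ₗ[ℂ] B →ₗ[ℂ] B) : Prop :=
  ∃ e : A ≃ₗ[ℂ] B, ∀ x y : A, e (β x y) = γ (e x) (e y)

/-- The bilinear product on `ℂ⁴` determined by structure constants
`f i j = [eᵢ, eⱼ]`. -/
def mkBil (f : Fin 4 → Fin 4 → Fin 4 → ℂ) :
    (Fin 4 → ℂ) →ₗ[ℂ] (Fin 4 → ℂ) →ₗ[ℂ] (Fin 4 → ℂ) :=
  LinearMap.mk₂ ℂ (fun x y => ∑ i, ∑ j, (x i * y j) • f i j)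
    (fun x x' y => by
      simp only [Pi.add_apply, add_mul, add_smul, Finset.sum_add_distrib])
    (fun c x y => by
      simp only [Pi.smul_apply, smul_eq_mul, Finset.smul_sum, mul_assoc, mul_smul])
    (fun x y y' => by
      simp only [Pi.add_apply, mul_add, add_smul, Finset.sum_add_distrib])
    (fun c x y => by
      simp only [Pi.smul_apply, smul_eq_mul, Finset.smul_sum, smul_smul, mul_left_comm])

/-- `E k` is the `k`-th standard basis vector of `ℂ⁴`. -/
def E (k : Fin 4) : Fin 4 → ℂ := Pi.single k 1

/-- Structure constants of the algebras `𝒜₁, …, 𝒜₂₅` (indices `0,1,2,3`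
correspond to `x₁, x₂, x₃, x₄`). -/
def sA1 : Fin 4 → Fin 4 → Fin 4 → ℂ :=
  ![![0, 0, E 3, 0], ![0, 0, 0, 0], ![0, E 3, 0, 0], 0]

def sA2 : Fin 4 → Fin 4 → Fin 4 → ℂ :=
  ![![0, 0, E 3, 0], ![0, E 3, E 3, 0], ![E 3, -E 3, 0, 0], 0]

def sA3 : Fin 4 → Fin 4 → Fin 4 → ℂ :=
  ![![0, E 3, 0, 0], ![-E 3, 0, 0, 0], ![0, 0, E 3, 0], 0]

def sA4 : Fin 4 → Fin 4 → Fin 4 → ℂ :=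
  ![![0, E 3, 0, 0], ![-E 3, E 3, 0, 0], ![0, 0, E 3, 0], 0]

def sA5 (c : ℂ) : Fin 4 → Fin 4 → Fin 4 → ℂ :=
  ![![0, E 3, 0, 0], ![c • E 3, 0, 0, 0], ![0, 0, E 3, 0], 0]

def sA6 : Fin 4 → Fin 4 → Fin 4 → ℂ :=
  ![![E 3, 0, 0, 0], ![0, E 3, 0, 0], ![0, 0, E 3, 0], 0]

def sA7 : Fin 4 → Fin 4 → Fin 4 → ℂ :=
  ![![E 1, E 2, E 3, 0], 0, 0, 0]

def sA8 : Fin 4 → Fin 4 → Fin 4 → ℂ :=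
  ![![E 3, E 2, 0, 0], ![-E 2, 0, 0, 0], 0, 0]

def sA9 : Fin 4 → Fin 4 → Fin 4 → ℂ :=
  ![![E 3, E 2, 0, 0], ![-E 2, E 3, 0, 0], 0, 0]

def sA10 : Fin 4 → Fin 4 → Fin 4 → ℂ :=
  ![![E 3, E 2, E 3, 0], ![-E 2, 0, 0, 0], ![-E 3, 0, 0, 0], 0]

def sA11 : Fin 4 → Fin 4 → Fin 4 → ℂ :=
  ![![0, E 2, E 3, 0], ![-E 2, E 3, 0, 0], ![-E 3, 0, 0, 0], 0]

def sA12 : Fin 4 → Fin 4 → Fin 4 → ℂ :=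
  ![![E 3, E 2, E 3, 0], ![-E 2 + E 3, 0, 0, 0], ![-E 3, 0, 0, 0], 0]

def sA13 : Fin 4 → Fin 4 → Fin 4 → ℂ :=
  ![![0, E 2, E 3, 0], ![-E 2 + E 3, E 3, 0, 0], ![-E 3, 0, 0, 0], 0]

def sA14 : Fin 4 → Fin 4 → Fin 4 → ℂ :=
  ![![E 2, E 3, 0, 0], 0, 0, 0]

def sA15 : Fin 4 → Fin 4 → Fin 4 → ℂ :=
  ![![E 2, 0, 0, 0], ![E 3, 0, 0, 0], 0, 0]

def sA16 : Fin 4 → Fin 4 → Fin 4 → ℂ :=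
  ![![0, E 3, 0, 0], ![E 2, -E 2, 0, 0], 0, 0]

def sA17 (α : ℂ) : Fin 4 → Fin 4 → Fin 4 → ℂ :=
  ![![E 2, E 3, 0, 0], ![α • E 3, 0, 0, 0], 0, 0]

def sA18 (α : ℂ) : Fin 4 → Fin 4 → Fin 4 → ℂ :=
  ![![E 2, α • E 2, 0, 0], ![E 3, -E 3, 0, 0], 0, 0]

def sA19 : Fin 4 → Fin 4 → Fin 4 → ℂ :=
  ![![E 2, E 2, 0, 0], ![E 2 + E 3, E 3, 0, 0], 0, 0]

def sA20 : Fin 4 → Fin 4 → Fin 4 → ℂ :=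
  ![![0, E 2, E 3, 0], 0, 0, 0]

def sA21 : Fin 4 → Fin 4 → Fin 4 → ℂ :=
  ![![0, E 2, E 3, 0], ![0, E 3, 0, 0], 0, 0]

def sA22 : Fin 4 → Fin 4 → Fin 4 → ℂ :=
  ![![0, E 2, E 3, 0], ![E 3, 0, 0, 0], 0, 0]

def sA23 : Fin 4 → Fin 4 → Fin 4 → ℂ :=
  ![![0, E 2, E 3, 0], ![E 3, E 3, 0, 0], 0, 0]

def sA24 : Fin 4 → Fin 4 → Fin 4 → ℂ :=
  ![![E 2, 0, E 3, 0], ![E 3, 0, 0, 0], 0, 0]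

def sA25 : Fin 4 → Fin 4 → Fin 4 → ℂ :=
  ![![E 2, 0, E 3, 0], ![0, E 3, 0, 0], 0, 0]

/-- The family `𝒜ᵢ`, `1 ≤ i ≤ 25`, with parameter `c` (used only for
`i = 5, 17, 18`). -/
def Alg : ℕ → ℂ → ((Fin 4 → ℂ) →ₗ[ℂ] (Fin 4 → ℂ) →ₗ[ℂ] (Fin 4 → ℂ))
  | 1, _ => mkBil sA1
  | 2, _ => mkBil sA2
  | 3, _ => mkBil sA3
  | 4, _ => mkBil sA4
  | 5, c => mkBil (sA5 c)
  | 6, _ => mkBil sA6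
  | 7, _ => mkBil sA7
  | 8, _ => mkBil sA8
  | 9, _ => mkBil sA9
  | 10, _ => mkBil sA10
  | 11, _ => mkBil sA11
  | 12, _ => mkBil sA12
  | 13, _ => mkBil sA13
  | 14, _ => mkBil sA14
  | 15, _ => mkBil sA15
  | 16, _ => mkBil sA16
  | 17, c => mkBil (sA17 c)
  | 18, c => mkBil (sA18 c)
  | 19, _ => mkBil sA19
  | 20, _ => mkBil sA20
  | 21, _ => mkBil sA21
  | 22, _ => mkBil sA22
  | 23, _ => mkBil sA23
  | 24, _ => mkBil sA24
  | 25, _ => mkBil sA25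
  | _, _ => 0

/-- Admissibility of the index `i` and the parameter `c` for the family `𝒜ᵢ`. -/
def Adm (i : ℕ) (c : ℂ) : Prop :=
  1 ≤ i ∧ i ≤ 25 ∧ (i = 5 → (c ≠ 1 ∧ c ≠ -1)) ∧
    (i = 17 → (c ≠ -1 ∧ c ≠ 0)) ∧ (i = 18 → c ≠ -1)

section GramMatrices

variable {V : Type*} [AddCommGroup V] [Module ℂ V]

/-- Some triple of vectors has Gram matrix `M` with respect to `f`. -/
def HasGram (f : V →ₗ[ℂ] V →ₗ[ℂ] ℂ) (M : Matrix (Fin 3) (Fin 3) ℂ) : Prop :=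
  ∃ v : Fin 3 → V, ∀ i j, f (v i) (v j) = M i j

theorem hasGram_of_eq {f : V →ₗ[ℂ] V →ₗ[ℂ] ℂ} {M : Matrix (Fin 3) (Fin 3) ℂ} (x y z : V)
    (hxx : f x x = M 0 0) (hxy : f x y = M 0 1) (hxz : f x z = M 0 2)
    (hyx : f y x = M 1 0) (hyy : f y y = M 1 1) (hyz : f y z = M 1 2)
    (hzx : f z x = M 2 0) (hzy : f z y = M 2 1) (hzz : f z z = M 2 2) : HasGram f M := by
  refine ⟨![x, y, z], fun i j => ?_⟩
  fin_cases i <;> fin_cases j <;> assumption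

theorem exists_sq_mul_eq_one {d : ℂ} (hd : d ≠ 0) : ∃ r : ℂ, r ≠ 0 ∧ r * r * d = 1 := by
  obtain ⟨r, hr⟩ := IsAlgClosed.exists_pow_nat_eq d⁻¹ (n := 2) two_pos
  have h : r * r * d = 1 := by rw [← sq, hr, inv_mul_cancel₀ hd]
  exact ⟨r, by rintro rfl; simp at h, h⟩

/-- A plane on which a form is not symmetric contains an isotropic vector that can be completed
to a pair on which the form is still not symmetric. -/
theorem exists_isotropic (f : V →ₗ[ℂ] V →ₗ[ℂ] ℂ) (p q : V) (h : f p q ≠ f q p) :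
    ∃ p' ∈ Submodule.span ℂ {p, q}, ∃ q' ∈ Submodule.span ℂ {p, q},
      f p' p' = 0 ∧ f p' q' ≠ f q' p' := by
  have hp : p ∈ Submodule.span ℂ {p, q} := Submodule.subset_span (by simp)
  have hq : q ∈ Submodule.span ℂ {p, q} := Submodule.subset_span (by simp)
  by_cases ha : f p p = 0
  · exact ⟨p, hp, q, hq, ha, h⟩
  obtain ⟨s, hs⟩ := IsAlgClosed.exists_pow_nat_eq
    (discrim (f p p) (f p q + f q p) (f q q)) (n := 2) two_pos
  obtain ⟨t, ht⟩ := exists_quadratic_eq_zero ha ⟨s, by rw [← hs, sq]⟩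
  refine ⟨q + t • p, add_mem hq (Submodule.smul_mem _ _ hp), p, hp, ?_, ?_⟩
  · simp only [map_add, map_smul, LinearMap.add_apply, LinearMap.smul_apply, smul_eq_mul]
    linear_combination ht
  · simp only [map_add, map_smul, LinearMap.add_apply, LinearMap.smul_apply, smul_eq_mul]
    exact fun hh => h (by linear_combination -hh)

/-- The Gram matrices of the six families of algebras. -/
def HasStandardGram (f : V →ₗ[ℂ] V →ₗ[ℂ] ℂ) : Prop :=
  HasGram f !![0, 0, 1; 0, 0, 0; 0, 1, 0] ∨
  HasGram f !![0, 0, 1; 0, 1, 1; 1, -1, 0] ∨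
  HasGram f !![0, 1, 0; -1, 0, 0; 0, 0, 1] ∨
  HasGram f !![0, 1, 0; -1, 1, 0; 0, 0, 1] ∨
  (∃ c : ℂ, c ≠ 1 ∧ c ≠ -1 ∧ HasGram f !![0, 1, 0; c, 0, 0; 0, 0, 1]) ∨
  HasGram f !![1, 0, 0; 0, 1, 0; 0, 0, 1]

/-- A unit vector plus an orthogonal pair with isotropic first member. -/
theorem hasStandardGram_of_isotropic (f : V →ₗ[ℂ] V →ₗ[ℂ] ℂ) (u p q : V) (huu : f u u = 1)
    (hup : f u p = 0) (hpu : f p u = 0) (huq : f u q = 0) (hqu : f q u = 0)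
    (hpp : f p p = 0) (hpq : f p q ≠ f q p) : HasStandardGram f := by
  by_cases hb : f p q + f q p = 0
  · have hqp : f q p = -f p q := by linear_combination hb
    have ha : f p q ≠ 0 := fun h => hpq (by rw [hqp, h, neg_zero])
    by_cases hd : f q q = 0
    · right; right; left
      refine hasGram_of_eq ((f p q)⁻¹ • p) q u ?_ ?_ ?_ ?_ ?_ ?_ ?_ ?_ ?_ <;>
        simp [huu, hup, hpu, huq, hqu, hpp, hqp, hd, ha]
    · obtain ⟨r, hr, hrd⟩ := exists_sq_mul_eq_one hd
      right; right; right; left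
      refine hasGram_of_eq ((f p q * r)⁻¹ • p) (r • q) u ?_ ?_ ?_ ?_ ?_ ?_ ?_ ?_ ?_ <;>
        simp [huu, hup, hpu, huq, hqu, hpp, hqp]
      · field_simp
      · field_simp
      · linear_combination hrd
  · obtain ⟨w, hw⟩ : ∃ w, w = q - (f q q / (f p q + f q p)) • p := ⟨_, rfl⟩
    have hww : f w w = 0 := by
      simp only [hw, map_sub, map_smul, LinearMap.sub_apply, LinearMap.smul_apply, smul_eq_mul,
        hpp]
      field_simp
      ring
    have hpw : f p w = f p q := by simp [hw, hpp]
    have hwp : f w p = f q p := by simp [hw, hpp]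
    have huw : f u w = 0 := by simp [hw, huq, hup]
    have hwu : f w u = 0 := by simp [hw, hqu, hpu]
    right; right; right; right; left
    by_cases ha : f p q = 0
    · have hc : f q p ≠ 0 := fun h => hpq (by rw [ha, h])
      refine ⟨0, by simp, by simp, ?_⟩
      refine hasGram_of_eq ((f q p)⁻¹ • w) p u ?_ ?_ ?_ ?_ ?_ ?_ ?_ ?_ ?_ <;>
        simp [huu, hup, hpu, huw, hwu, hpp, hww, hpw, hwp, ha, hc]
    · refine ⟨f q p / f p q, ?_, ?_, ?_⟩
      · exact fun h => hpq (by field_simp at h; exact h.symm)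
      · exact fun h => hb (by field_simp at h; linear_combination h)
      · refine hasGram_of_eq ((f p q)⁻¹ • p) w u ?_ ?_ ?_ ?_ ?_ ?_ ?_ ?_ ?_ <;>
          simp [huu, hup, hpu, huw, hwu, hpp, hww, hpw, hwp, ha]
        field_simp

theorem hasStandardGram_of_anisotropic (f : V →ₗ[ℂ] V →ₗ[ℂ] ℂ) (u p q : V)
    (hu : ∀ x, f u x = f x u) (huu : f u u ≠ 0) (hpq : f p q ≠ f q p) : HasStandardGram f := by
  obtain ⟨r, -, hr⟩ := exists_sq_mul_eq_one huu
  obtain ⟨e, he⟩ : ∃ e, e = r • u := ⟨_, rfl⟩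
  have hee : f e e = 1 := by simp [he]; linear_combination hr
  have hex : ∀ x, f e x = f x e := fun x => by simp [he, hu]
  obtain ⟨x, hx, y, hy, hxx, hxy⟩ := exists_isotropic f (p - f e p • e) (q - f e q • e) (by
    simp only [map_sub, map_smul, LinearMap.sub_apply, LinearMap.smul_apply, smul_eq_mul, hee,
      ← hex]
    exact fun h => hpq (by linear_combination h))
  have hle : Submodule.span ℂ {p - f e p • e, q - f e q • e} ≤ LinearMap.ker (f e) := by
    rw [Submodule.span_le]
    rintro z (rfl | rfl) <;> simp [hee]
  have hx0 : f e x = 0 := hle hx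
  have hy0 : f e y = 0 := hle hy
  exact hasStandardGram_of_isotropic f e x y hee hx0 (by rw [← hex, hx0]) hy0
    (by rw [← hex, hy0]) hxx hxy

theorem hasStandardGram_of_hyperbolic (f : V →ₗ[ℂ] V →ₗ[ℂ] ℂ) (u w t : V)
    (huu : f u u = 0) (huw : f u w = 1) (hwu : f w u = 1) (hww : f w w = 0)
    (hut : f u t = 0) (htu : f t u = 0) (hwt : f w t ≠ 0) (htw : f t w = -f w t) :
    HasStandardGram f := by
  by_cases hd : f t t = 0
  · left
    obtain ⟨s, hs⟩ : ∃ s, s = (f w t)⁻¹ • t := ⟨_, rfl⟩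
    have hus : f u s = 0 := by simp [hs, hut]
    have hsu : f s u = 0 := by simp [hs, htu]
    have hss : f s s = 0 := by simp [hs, hd]
    have hws : f w s = 1 := by simp [hs, hwt]
    have hsw : f s w = -1 := by simp [hs, htw, hwt]
    refine hasGram_of_eq ((1 / 2 : ℂ) • (u - s)) ((1 / 2 : ℂ) • (u + s)) w
      ?_ ?_ ?_ ?_ ?_ ?_ ?_ ?_ ?_ <;>
      simp [huu, huw, hwu, hww, hus, hsu, hss, hws, hsw] <;> norm_num
  · right; left
    obtain ⟨r, hr, hrd⟩ := exists_sq_mul_eq_one hd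
    refine hasGram_of_eq (-(r * f w t) • u) (r • t) (-(r * f w t)⁻¹ • w)
      ?_ ?_ ?_ ?_ ?_ ?_ ?_ ?_ ?_ <;>
      simp [huu, huw, hwu, hww, hut, htu, htw] <;> field_simp
    linear_combination hrd

theorem hasStandardGram_of_isotropic_kernel (f : V →ₗ[ℂ] V →ₗ[ℂ] ℂ) (u p q : V)
    (hu : ∀ x, f u x = f x u) (huu : f u u = 0) (hup : f u p ≠ 0) (hpq : f p q ≠ f q p) :
    HasStandardGram f := by
  obtain ⟨x, hx⟩ : ∃ x, x = (f u p)⁻¹ • p := ⟨_, rfl⟩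
  have hux : f u x = 1 := by simp [hx, hup]
  have hxq : f x q ≠ f q x := by simpa [hx, hup] using hpq
  obtain ⟨w, hw⟩ : ∃ w, w = x - (f x x / 2) • u := ⟨_, rfl⟩
  have huw : f u w = 1 := by simp [hw, hux, huu]
  have hww : f w w = 0 := by
    simp [hw, hux, huu, ← hu]
    ring
  have hwq : f w q ≠ f q w := by simpa [hw, hu] using hxq
  obtain ⟨t, ht⟩ : ∃ t, t = q - f u q • w - ((f w q + f q w) / 2) • u := ⟨_, rfl⟩
  have hwu : f w u = 1 := by rw [← hu, huw]
  have hut : f u t = 0 := by simp [ht, huw, huu]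
  have hwt : f w t = (f w q - f q w) / 2 := by simp [ht, hwu, hww]; ring
  have htw : f t w = -f w t := by rw [hwt]; simp [ht, huw, hww]; ring
  refine hasStandardGram_of_hyperbolic f u w t huu huw hwu hww hut (by rw [← hu, hut]) ?_ htw
  rw [hwt]
  exact div_ne_zero (sub_ne_zero.2 hwq) two_ne_zero

theorem hasStandardGram_of_symm (f : V →ₗ[ℂ] V →ₗ[ℂ] ℂ) (hV : Module.finrank ℂ V = 3)
    (hrad : ∀ x, (∀ y, f x y = 0 ∧ f y x = 0) → x = 0) (hf : ∀ x y, f x y = f y x) :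
    HasStandardGram f := by
  have : FiniteDimensional ℂ V := .of_finrank_pos (by omega)
  obtain ⟨b, hb⟩ := LinearMap.BilinForm.exists_orthogonal_basis (B := f) ⟨hf⟩
  obtain ⟨v, hv⟩ : ∃ v : Module.Basis (Fin 3) ℂ V, ∀ i j, i ≠ j → f (v i) (v j) = 0 :=
    ⟨b.reindex (finCongr hV), fun i j hij => by
      simpa using hb (fun h => hij ((finCongr hV).symm.injective h))⟩
  have hd : ∀ i, f (v i) (v i) ≠ 0 := fun i h => v.ne_zero i <| hrad _ fun y => by
    have h0 : f (v i) = 0 := v.ext fun j => by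
      by_cases hij : i = j
      · rw [← hij, h, LinearMap.zero_apply]
      · rw [hv i j hij, LinearMap.zero_apply]
    rw [hf y, h0]
    simp
  choose r hr hrd using fun i => exists_sq_mul_eq_one (hd i)
  right; right; right; right; right
  refine ⟨fun i => r i • v i, fun i j => ?_⟩
  have h1 : (!![1, 0, 0; 0, 1, 0; 0, 0, 1] : Matrix (Fin 3) (Fin 3) ℂ) = 1 := by
    rw [Matrix.one_fin_three]
  rw [h1, Matrix.one_apply]
  split_ifs with h
  · subst h
    simpa [mul_assoc] using hrd i
  · simp [hv i j h]

/-- Every bilinear form on a 3-dimensional complex space whose two-sided radical vanishes is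
equivalent to one of the standard ones. -/
theorem hasStandardGram (f : V →ₗ[ℂ] V →ₗ[ℂ] ℂ) (hV : Module.finrank ℂ V = 3)
    (hrad : ∀ x, (∀ y, f x y = 0 ∧ f y x = 0) → x = 0) : HasStandardGram f := by
  have : FiniteDimensional ℂ V := .of_finrank_pos (by omega)
  by_cases hsymm : ∀ x y, f x y = f y x
  · exact hasStandardGram_of_symm f hV hrad hsymm
  push Not at hsymm
  obtain ⟨p, q, hpq⟩ := hsymm
  -- `u` spans the kernel of the alternating part of `f`
  let b : Module.Basis (Fin 3) ℂ V := Module.finBasisOfFinrankEq ℂ V hV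
  let k (i j : Fin 3) : ℂ := f (b i) (b j) - f (b j) (b i)
  obtain ⟨u, hu_def⟩ : ∃ u, u = k 1 2 • b 0 - k 0 2 • b 1 + k 0 1 • b 2 := ⟨_, rfl⟩
  have hu : ∀ x, f u x = f x u := by
    have : f u = f.flip u := b.ext fun i => by
      simp only [hu_def, k, map_add, map_sub, map_smul, LinearMap.add_apply, LinearMap.sub_apply,
        LinearMap.smul_apply, LinearMap.flip_apply, smul_eq_mul]
      fin_cases i <;> simp <;> ring
    exact fun x => by rw [this, LinearMap.flip_apply]
  have hu0 : u ≠ 0 := by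
    intro h0
    have hk : ∀ i, ![k 1 2, -k 0 2, k 0 1] i = 0 :=
      Fintype.linearIndependent_iff.1 b.linearIndependent _ (by
        rw [Fin.sum_univ_three, ← h0, hu_def]
        simp [sub_eq_add_neg])
    have h12 : k 1 2 = 0 := hk 0
    have h02 : k 0 2 = 0 := neg_eq_zero.1 (hk 1)
    have h01 : k 0 1 = 0 := hk 2
    apply hpq
    have : f = f.flip := b.ext fun i => b.ext fun j => by
      simp only [k, sub_eq_zero] at h12 h02 h01
      fin_cases i <;> fin_cases j <;> simp [h12, h02, h01]
    conv_lhs => rw [this, LinearMap.flip_apply]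
  by_cases huu : f u u = 0
  · by_cases hup : f u p = 0
    · by_cases huq : f u q = 0
      · exfalso
        have hli : LinearIndependent ℂ ![u, p, q] := by
          rw [Fintype.linearIndependent_iff]
          intro g hg
          rw [Fin.sum_univ_three] at hg
          simp only [Matrix.cons_val] at hg
          have hp := congrArg (fun x => f x p - f p x) hg
          have hq := congrArg (fun x => f x q - f q x) hg
          simp [hu] at hp hq
          have h2 : g 2 = 0 := by
            have : g 2 * (f p q - f q p) = 0 := by linear_combination -hp
            exact (mul_eq_zero.1 this).resolve_right (sub_ne_zero.2 hpq)
          have h1 : g 1 = 0 := by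
            have : g 1 * (f p q - f q p) = 0 := by linear_combination hq
            exact (mul_eq_zero.1 this).resolve_right (sub_ne_zero.2 hpq)
          have h0 : g 0 = 0 := by simpa [h1, h2, hu0] using hg
          intro i
          fin_cases i <;> assumption
        apply hu0
        apply hrad
        have h0 : f u = 0 :=
          (basisOfLinearIndependentOfCardEqFinrank hli (by simp [hV])).ext fun i => by
            fin_cases i <;> simp [huu, hup, huq]
        intro y
        rw [← hu, h0]
        simp
      · exact hasStandardGram_of_isotropic_kernel f u q p hu huu huq hpq.symm
    · exact hasStandardGram_of_isotropic_kernel f u p q hu huu hup hpq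
  · exact hasStandardGram_of_anisotropic f u p q hu huu hpq

end GramMatrices

section Leibniz

variable {A : Type*} [AddCommGroup A] [Module ℂ A]

theorem leibIso_mkBil (β : A →ₗ[ℂ] A →ₗ[ℂ] A) (b : Module.Basis (Fin 4) ℂ A)
    (s : Fin 4 → Fin 4 → Fin 4 → ℂ) (h : ∀ i j, b.equivFun (β (b i) (b j)) = s i j) :
    LeibIso β (mkBil s) := by
  refine ⟨b.equivFun, fun x y => ?_⟩
  conv_lhs => rw [← b.sum_equivFun x, ← b.sum_equivFun y]
  simp only [map_sum, map_smul, LinearMap.sum_apply, LinearMap.smul_apply, h, mkBil,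
    LinearMap.mk₂_apply, mul_smul]
  rw [Finset.sum_comm]
  refine Finset.sum_congr rfl fun i _ => ?_
  rw [Finset.smul_sum]
  exact Finset.sum_congr rfl fun j _ => smul_comm _ _ _

/-- An algebra whose product is `f x y • z` with `z` central is determined by the Gram matrix of
`f` on three vectors, provided that matrix has no two-sided radical. -/
theorem leibIso_of_gram (β : A →ₗ[ℂ] A →ₗ[ℂ] A) (hdim : Module.finrank ℂ A = 4)
    (f : A →ₗ[ℂ] A →ₗ[ℂ] ℂ) (z : A) (hz : z ≠ 0) (hβ : ∀ x y, β x y = f x y • z)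
    (hzl : ∀ x, f z x = 0) (hzr : ∀ x, f x z = 0)
    (M : Matrix (Fin 3) (Fin 3) ℂ) (hM : HasGram f M)
    (hrad : ∀ c : Fin 3 → ℂ, (∀ j, ∑ i, c i * M i j = 0) → (∀ j, ∑ i, c i * M j i = 0) →
      ∀ i, c i = 0)
    (s : Fin 4 → Fin 4 → Fin 4 → ℂ)
    (hs : ∀ i j, s (Fin.castSucc i) (Fin.castSucc j) = M i j • E 3)
    (hsl : ∀ j, s 3 j = 0) (hsr : ∀ i, s i 3 = 0) : LeibIso β (mkBil s) := by
  obtain ⟨v, hv⟩ := hM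
  have hli : LinearIndependent ℂ (Fin.snoc v z : Fin 4 → A) := by
    rw [Fintype.linearIndependent_iff]
    intro g hg
    rw [Fin.sum_univ_castSucc] at hg
    simp only [Fin.snoc_castSucc, Fin.snoc_last] at hg
    have hc : ∀ i : Fin 3, g i.castSucc = 0 := by
      apply hrad
      · intro j
        simpa [hzl, hv] using congrArg (fun x => f x (v j)) hg
      · intro j
        simpa [hzr, hv] using congrArg (fun x => f (v j) x) hg
    have h3 : g (Fin.last 3) = 0 := by simpa [hc, hz] using hg
    exact fun i => Fin.lastCases h3 hc i
  let b := basisOfLinearIndependentOfCardEqFinrank hli (by simp [hdim])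
  have hb : ∀ i : Fin 3, b i.castSucc = v i := fun i => by simp [b]
  have hb3 : b 3 = z := by
    have : b (Fin.last 3) = z := by
      rw [coe_basisOfLinearIndependentOfCardEqFinrank, Fin.snoc_last]
    exact this
  have hE : b.equivFun z = E 3 := by
    rw [← hb3]
    ext i
    simp [E, Pi.single_apply, eq_comm]
  refine leibIso_mkBil β b s fun i j => ?_
  rw [hβ, map_smul, hE]
  refine Fin.lastCases ?_ (fun i => ?_) i
  · change f (b 3) _ • _ = s 3 j
    rw [hb3, hzl, hsl, zero_smul]
  · refine Fin.lastCases ?_ (fun j => ?_) j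
    · change f _ (b 3) • _ = s _ 3
      rw [hb3, hzr, hsr, zero_smul]
    · rw [hb, hb, hv, hs]

/-- If `A²` is a line and `A` is nilpotent, the product is `f x y • z` with `z` central. -/
theorem exists_form (β : A →ₗ[ℂ] A →ₗ[ℂ] A) (hleib : IsLeibniz β) (hnilp : LeibNilpotent β)
    (hA2 : Module.finrank ℂ (lpow β 2) = 1) :
    ∃ (f : A →ₗ[ℂ] A →ₗ[ℂ] ℂ) (z : A), z ≠ 0 ∧ (∀ x y, β x y = f x y • z) ∧
      (∀ x, f z x = 0) ∧ (∀ x, f x z = 0) := by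
  obtain ⟨⟨z, hz⟩, hz0, hspan⟩ := finrank_eq_one_iff'.1 hA2
  have hz0 : z ≠ 0 := fun h => hz0 (Subtype.ext h)
  have hmem : ∀ x y, β x y ∈ lpow β 2 := fun x y =>
    Submodule.subset_span ⟨x, y, Submodule.mem_top, rfl⟩
  obtain ⟨φ, hφ, -⟩ := Submodule.exists_le_ker_of_notMem (p := (⊥ : Submodule ℂ A)) (v := z) hz0
  let f : A →ₗ[ℂ] A →ₗ[ℂ] ℂ := β.compr₂ ((φ z)⁻¹ • φ)
  have hβ : ∀ x y, β x y = f x y • z := by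
    intro x y
    obtain ⟨c, hc⟩ := hspan ⟨β x y, hmem x y⟩
    have hc : c • z = β x y := congrArg Subtype.val hc
    simp only [f, LinearMap.compr₂_apply, LinearMap.smul_apply, ← hc, map_smul, smul_eq_mul]
    congr 1
    field_simp
  have hr : ∀ x, f x z = 0 := by
    intro x
    by_contra hne
    have hall : ∀ n, z ∈ lpow β n ∧ z ∈ lpow β (n + 1) := by
      intro n
      induction n with
      | zero => exact ⟨Submodule.mem_top, Submodule.mem_top⟩
      | succ n ih =>
        refine ⟨ih.2, ?_⟩
        have h : β x z ∈ lpow β (n + 1 + 1) := Submodule.subset_span ⟨x, z, ih.2, rfl⟩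
        rw [hβ] at h
        exact (Submodule.smul_mem_iff _ hne).1 h
    obtain ⟨n, hn⟩ := hnilp
    have := (hall n).1
    rw [hn] at this
    exact hz0 this
  refine ⟨f, z, hz0, hβ, fun x => ?_, hr⟩
  have hle : lpow β 2 ≤ LinearMap.ker (β.flip x) := by
    refine Submodule.span_le.2 ?_
    rintro _ ⟨a, b, -, rfl⟩
    have h := hleib a b x
    rw [hβ b x, hβ a x, map_smul, map_smul, hβ a z, hβ b z, hr, hr] at h
    simpa using h.symm
  have h : β z x = 0 := hle hz
  rw [hβ] at h
  exact (smul_eq_zero.1 h).resolve_right hz0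

/-- In a non-split algebra with product `f x y • z`, the two-sided radical of `f` is spanned
by `z`. -/
theorem mem_span_of_radical (β : A →ₗ[ℂ] A →ₗ[ℂ] A) (hns : ¬ LeibIsSplit β)
    (f : A →ₗ[ℂ] A →ₗ[ℂ] ℂ) (z : A) (hz : z ≠ 0) (hβ : ∀ x y, β x y = f x y • z)
    (x : A) (hx : ∀ y, f x y = 0 ∧ f y x = 0) : x ∈ Submodule.span ℂ {z} := by
  by_contra hxz
  obtain ⟨ψ, hψx, hψ⟩ := Submodule.exists_le_ker_of_notMem hxz
  have hψz : ψ z = 0 := hψ (Submodule.mem_span_singleton_self z)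
  refine hns ⟨Submodule.span ℂ {x}, LinearMap.ker ψ, ?_, ?_, ?_, ?_, ?_, ?_⟩
  · intro w hw a
    obtain ⟨c, rfl⟩ := Submodule.mem_span_singleton.1 hw
    simp [hβ, hx]
  · intro w _ a
    simp [hβ, hψz]
  · rw [Ne, Submodule.span_singleton_eq_bot]
    rintro rfl
    exact hψx (map_zero ψ)
  · exact fun h => hz (by simpa [h] using (show z ∈ LinearMap.ker ψ from hψz))
  · rw [Submodule.eq_bot_iff]
    rintro w ⟨hw, hw'⟩
    obtain ⟨c, rfl⟩ := Submodule.mem_span_singleton.1 hw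
    have : c * ψ x = 0 := by simpa using hw'
    rw [(mul_eq_zero.1 this).resolve_right hψx, zero_smul]
  · rw [eq_top_iff]
    intro w _
    refine Submodule.mem_sup.2 ⟨(ψ w / ψ x) • x,
      Submodule.smul_mem _ _ (Submodule.mem_span_singleton_self x), w - (ψ w / ψ x) • x, ?_, ?_⟩
    · simp [hψx]
    · abel

/-- A bilinear form on a 4-dimensional space whose two-sided radical is a line is standard. -/
theorem hasStandardGram_of_radical_line (hdim : Module.finrank ℂ A = 4)
    (f : A →ₗ[ℂ] A →ₗ[ℂ] ℂ) (z : A) (hz : z ≠ 0)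
    (hzl : ∀ x, f z x = 0) (hzr : ∀ x, f x z = 0)
    (hrad : ∀ x, (∀ y, f x y = 0 ∧ f y x = 0) → x ∈ Submodule.span ℂ {z}) :
    HasStandardGram f := by
  have : FiniteDimensional ℂ A := .of_finrank_pos (by omega)
  obtain ⟨C, hC⟩ := Submodule.exists_isCompl (Submodule.span ℂ {z})
  have hC3 : Module.finrank ℂ C = 3 := by
    have := Submodule.finrank_add_eq_of_isCompl hC
    rw [finrank_span_singleton hz] at this
    omega
  have hgram : ∀ M, HasGram (f.domRestrict₁₂ C C) M → HasGram f M :=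
    fun M ⟨v, hv⟩ => ⟨fun i => v i, hv⟩
  have key : HasStandardGram (f.domRestrict₁₂ C C) := by
    refine hasStandardGram _ hC3 fun x hx => ?_
    have hxz : (x : A) ∈ Submodule.span ℂ {z} := by
      refine hrad _ fun y => ?_
      obtain ⟨w, hw, c, hc, rfl⟩ := Submodule.mem_sup.1
        (hC.sup_eq_top ▸ Submodule.mem_top : y ∈ Submodule.span ℂ {z} ⊔ C)
      obtain ⟨a, rfl⟩ := Submodule.mem_span_singleton.1 hw
      have := hx ⟨c, hc⟩
      simp only [LinearMap.domRestrict₁₂_apply] at this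
      simp [hzl, hzr, this]
    exact Subtype.ext (Submodule.disjoint_def.1 hC.disjoint _ hxz x.2)
  refine key.imp (hgram _) (Or.imp (hgram _) (Or.imp (hgram _) (Or.imp (hgram _) (Or.imp ?_
    (hgram _)))))
  exact fun ⟨c, h1, h2, h⟩ => ⟨c, h1, h2, hgram _ h⟩

end Leibniz

/-- Classification of 4-dimensional non-split non-Lie nilpotent Leibniz algebras
over ℂ with `dim A² = 1` (Demir–Misra–Stitzinger, Theorem 2.1). -/
theorem four_dim_nilpotent_dimAsq_one
    {A : Type*} [AddCommGroup A] [Module ℂ A]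
    (β : A →ₗ[ℂ] A →ₗ[ℂ] A) (hleib : IsLeibniz β)
    (hdim : Module.finrank ℂ A = 4)
    (hnonsplit : ¬ LeibIsSplit β)
    (hnonlie : leibSpan β ≠ ⊥)
    (hnilp : LeibNilpotent β)
    (hA2 : Module.finrank ℂ (lpow β 2) = 1) :
    LeibIso β (mkBil sA1) ∨ LeibIso β (mkBil sA2) ∨ LeibIso β (mkBil sA3) ∨
      LeibIso β (mkBil sA4) ∨
      (∃ c : ℂ, c ≠ 1 ∧ c ≠ -1 ∧ LeibIso β (mkBil (sA5 c))) ∨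
      LeibIso β (mkBil sA6) := by
  obtain ⟨f, z, hz, hβ, hzl, hzr⟩ := exists_form β hleib hnilp hA2
  have iso := leibIso_of_gram β hdim f z hz hβ hzl hzr
  rcases hasStandardGram_of_radical_line hdim f z hz hzl hzr
    (mem_span_of_radical β hnonsplit f z hz hβ) with h | h | h | h | ⟨c, h1, hm1, h⟩ | h
  · refine .inl (iso _ h ?_ _ ?_ ?_ ?_)
    · intro c hl hr
      simp [Fin.forall_fin_succ, Fin.sum_univ_three] at hl hr ⊢
      grind
    all_goals simp [sA1, Fin.forall_fin_succ]
  · refine .inr (.inl (iso _ h ?_ _ ?_ ?_ ?_))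
    · intro c hl hr
      simp [Fin.forall_fin_succ, Fin.sum_univ_three] at hl hr ⊢
      grind
    all_goals simp [sA2, Fin.forall_fin_succ]
  · refine .inr (.inr (.inl (iso _ h ?_ _ ?_ ?_ ?_)))
    · intro c hl hr
      simp [Fin.forall_fin_succ, Fin.sum_univ_three] at hl hr ⊢
      grind
    all_goals simp [sA3, Fin.forall_fin_succ]
  · refine .inr (.inr (.inr (.inl (iso _ h ?_ _ ?_ ?_ ?_))))
    · intro c hl hr
      simp [Fin.forall_fin_succ, Fin.sum_univ_three] at hl hr ⊢
      grind
    all_goals simp [sA4, Fin.forall_fin_succ]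
  · refine .inr (.inr (.inr (.inr (.inl ⟨c, h1, hm1, iso _ h ?_ _ ?_ ?_ ?_⟩))))
    · intro c hl hr
      simp [Fin.forall_fin_succ, Fin.sum_univ_three] at hl hr ⊢
      grind
    all_goals simp [sA5, Fin.forall_fin_succ]
  · refine .inr (.inr (.inr (.inr (.inr (iso _ h ?_ _ ?_ ?_ ?_)))))
    · intro c hl hr
      simp [Fin.forall_fin_succ, Fin.sum_univ_three] at hl hr ⊢
      grind
    all_goals simp [sA6, Fin.forall_fin_succ]
end
end

section
/- Let A be a 4-dimensional non-split non-Lie nilpotent Leibniz algebra over ℂ with dim A² = 3. Then A is isomorphic to the Leibniz algebra A7 with basis {x1,x2,x3,x4} whose nonzero products are [x1,x1]=x2, [x1,x2]=x3, [x1,x3]=x4. -/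
noncomputable section

section Aux

variable {A : Type*} [AddCommGroup A] [Module ℂ A] {β : A →ₗ[ℂ] A →ₗ[ℂ] A}

theorem mem_lpow_succ {n : ℕ} {b : A} (hb : b ∈ lpow β n) (hn : 1 ≤ n) (a : A) :
    β a b ∈ lpow β (n + 1) := by
  obtain ⟨m, rfl⟩ := Nat.exists_eq_add_of_le' hn
  exact Submodule.subset_span ⟨a, b, hb, rfl⟩

/-- Left multiplication by an element of `A²` raises the degree by two. -/
theorem bracket_lpow_two_mem (hleib : IsLeibniz β) {n : ℕ} (hn : 1 ≤ n) {a b : A}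
    (ha : a ∈ lpow β 2) (hb : b ∈ lpow β n) : β a b ∈ lpow β (n + 2) := by
  have key : lpow β 2 ≤ (lpow β (n + 2)).comap (β.flip b) := by
    refine Submodule.span_le.2 ?_
    rintro _ ⟨x, y, -, rfl⟩
    change β (β x y) b ∈ lpow β (n + 2)
    rw [← sub_eq_of_eq_add (hleib x y b)]
    exact sub_mem (mem_lpow_succ (mem_lpow_succ hb hn y) (by omega) x)
      (mem_lpow_succ (mem_lpow_succ hb hn x) (by omega) y)
  exact key ha

theorem lpow_le_range_sup (hleib : IsLeibniz β) {v : A}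
    (hv : Submodule.span ℂ {v} ⊔ lpow β 2 = ⊤) (n : ℕ) :
    lpow β (n + 2) ≤ LinearMap.range (β v) ⊔ lpow β (n + 3) := by
  refine Submodule.span_le.2 ?_
  rintro _ ⟨a, b, hb, rfl⟩
  have ha : a ∈ Submodule.span ℂ {v} ⊔ lpow β 2 := hv ▸ Submodule.mem_top
  obtain ⟨_, hs, a', ha', rfl⟩ := Submodule.mem_sup.1 ha
  obtain ⟨s, rfl⟩ := Submodule.mem_span_singleton.1 hs
  rw [map_add, LinearMap.add_apply, map_smul, LinearMap.smul_apply, ← map_smul]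
  exact Submodule.add_mem_sup ⟨s • b, rfl⟩
    (bracket_lpow_two_mem hleib (by omega) ha' hb)

theorem lpow_two_le_range (hleib : IsLeibniz β) {v : A}
    (hv : Submodule.span ℂ {v} ⊔ lpow β 2 = ⊤) {m : ℕ} (hm : lpow β (m + 2) = ⊥) :
    lpow β 2 ≤ LinearMap.range (β v) := by
  have key : ∀ n, lpow β 2 ≤ LinearMap.range (β v) ⊔ lpow β (n + 2) := by
    intro n
    induction n with
    | zero => exact le_sup_right
    | succ n ih =>
      exact ih.trans (sup_le le_sup_left (lpow_le_range_sup hleib hv n))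
  simpa [hm] using key m

theorem pow_apply_mem_lpow (v x : A) (n : ℕ) : ((β v) ^ n) x ∈ lpow β (n + 1) := by
  induction n with
  | zero => exact Submodule.mem_top
  | succ n ih =>
    rw [pow_succ', Module.End.mul_apply]
    exact mem_lpow_succ ih (by omega) v

theorem bracket_self_left_eq_zero (hleib : IsLeibniz β) (a : A) : β (β a a) = 0 := by
  ext c
  simpa using hleib a a c

theorem bracket_left_eq_zero (hleib : IsLeibniz β) {w : A} (hw : β w = 0) (a : A) :
    β (β a w) = 0 := by
  ext c
  simpa [hw] using (hleib a w c).symm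

theorem LeibNilpotent.exists_lpow_add_two (hnilp : LeibNilpotent β) [Nontrivial A] :
    ∃ m, lpow β (m + 2) = ⊥ := by
  obtain ⟨n, hn⟩ := hnilp
  match n, hn with
  | 0, hn => exact absurd hn top_ne_bot
  | 1, hn => exact absurd hn top_ne_bot
  | m + 2, hn => exact ⟨m, hn⟩

/-- A vector whose line complements the image of a nilpotent endomorphism is cyclic. -/
theorem span_pow_apply_eq_top {f : Module.End ℂ A} {v : A} {n : ℕ} (hf : f ^ n = 0)
    (hv : Submodule.span ℂ {v} ⊔ LinearMap.range f = ⊤) :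
    Submodule.span ℂ (Set.range fun i : Fin n => (f ^ (i : ℕ)) v) = ⊤ := by
  set S := Submodule.span ℂ (Set.range fun i : Fin n => (f ^ (i : ℕ)) v) with hS
  have key : ∀ k ≤ n, ∀ x, ∃ y, x - (f ^ k) y ∈ S := by
    intro k
    induction k with
    | zero => exact fun _ x => ⟨x, by simp⟩
    | succ k ih =>
      intro hk x
      obtain ⟨y, hy⟩ := ih (by omega) x
      have hy' : y ∈ Submodule.span ℂ {v} ⊔ LinearMap.range f := hv ▸ Submodule.mem_top
      obtain ⟨_, hs, _, ⟨z, rfl⟩, rfl⟩ := Submodule.mem_sup.1 hy'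
      obtain ⟨s, rfl⟩ := Submodule.mem_span_singleton.1 hs
      refine ⟨z, ?_⟩
      have hmem : (f ^ k) v ∈ S := Submodule.subset_span ⟨⟨k, hk⟩, rfl⟩
      have := add_mem hy (S.smul_mem s hmem)
      rw [map_add, map_smul] at this
      rw [pow_succ, Module.End.mul_apply]
      convert this using 1
      abel
  rw [eq_top_iff]
  intro x _
  obtain ⟨y, hy⟩ := key n le_rfl x
  simpa [hf] using hy

end Aux

/-- Classification of 4-dimensional non-split non-Lie nilpotent Leibniz algebras
over ℂ with `dim A² = 3`. -/
theorem four_dim_nilpotent_dimAsq_three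
    {A : Type*} [AddCommGroup A] [Module ℂ A]
    (β : A →ₗ[ℂ] A →ₗ[ℂ] A) (hleib : IsLeibniz β)
    (hdim : Module.finrank ℂ A = 4)
    (hnonsplit : ¬ LeibIsSplit β)
    (hnonlie : leibSpan β ≠ ⊥)
    (hnilp : LeibNilpotent β)
    (hA2 : Module.finrank ℂ (lpow β 2) = 3) :
    LeibIso β (mkBil sA7) := by
  have : Module.Finite ℂ A := Module.finite_of_finrank_pos (by omega)
  have : Nontrivial A := Module.nontrivial_of_finrank_pos (R := ℂ) (by omega)
  obtain ⟨m, hm⟩ := hnilp.exists_lpow_add_two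
  obtain ⟨v, hv⟩ : ∃ v, v ∉ lpow β 2 := by
    by_contra! h
    rw [(Submodule.eq_top_iff').2 h, finrank_top] at hA2
    omega
  have hsup : Submodule.span ℂ {v} ⊔ lpow β 2 = ⊤ := by
    have hlt : lpow β 2 < Submodule.span ℂ {v} ⊔ lpow β 2 :=
      lt_of_le_of_ne le_sup_right fun h =>
        hv (h ▸ Submodule.mem_sup_left (Submodule.mem_span_singleton_self v))
    have := Submodule.finrank_lt_finrank_of_lt hlt
    have := Submodule.finrank_le (Submodule.span ℂ {v} ⊔ lpow β 2)
    exact Submodule.eq_top_of_finrank_eq (by omega)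
  have hrange : Submodule.span ℂ {v} ⊔ LinearMap.range (β v) = ⊤ :=
    top_le_iff.1 (hsup ▸ sup_le_sup_left (lpow_two_le_range hleib hsup hm) _)
  have hpow : (β v) ^ 4 = 0 := by
    ext x
    have hx : x ∈ LinearMap.ker ((β v) ^ (m + 1)) := by
      have := pow_apply_mem_lpow (β := β) v x (m + 1)
      rwa [hm, Submodule.mem_bot] at this
    have := Module.End.ker_pow_le_ker_pow_finrank (β v) (m + 1) hx
    rwa [hdim] at this
  let b := basisOfTopLeSpanOfCardEqFinrank (fun i : Fin 4 => ((β v) ^ (i : ℕ)) v)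
    (span_pow_apply_eq_top hpow hrange).ge (by simp [hdim])
  have hb : ∀ i : Fin 4, b i = ((β v) ^ (i : ℕ)) v := fun i => by simp [b]
  have hb0 : b 0 = v := by simp [hb]
  have hb1 : β v v = b 1 := by simp [hb]
  have hb2 : β v (b 1) = b 2 := by simp [hb, pow_succ']
  have hb3 : β v (b 2) = b 3 := by simp [hb, pow_succ']
  have hb4 : β v (b 3) = 0 := by
    simpa [hb, pow_succ'] using LinearMap.congr_fun hpow v
  have hl1 : β (b 1) = 0 := hb1 ▸ bracket_self_left_eq_zero hleib v
  have hl2 : β (b 2) = 0 := hb2 ▸ bracket_left_eq_zero hleib hl1 v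
  have hl3 : β (b 3) = 0 := hb3 ▸ bracket_left_eq_zero hleib hl2 v
  refine ⟨b.equivFun, fun x y => ?_⟩
  obtain ⟨x, rfl⟩ := b.equivFun.symm.surjective x
  obtain ⟨y, rfl⟩ := b.equivFun.symm.surjective y
  rw [LinearEquiv.apply_symm_apply, LinearEquiv.apply_symm_apply,
    ← LinearEquiv.eq_symm_apply]
  simp [Module.Basis.equivFun_symm_apply, Fin.sum_univ_four, hl1, hl2, hl3, hb0, hb1, hb2, hb3,
    hb4, mkBil, sA7, E, smul_smul]
end
end

section
/- Let A be a 4-dimensional non-split non-Lie nilpotent Leibniz algebra over ℂ with dim A² = 2, dim A³ = 0 and dim Leib(A) = 1. Then A is isomorphic to the Leibniz algebra with basis {x1,x2,x3,x4} whose nonzero products are given by one of the following: (A8) [x1,x1]=x4, [x1,x2]=x3, [x2,x1]=−x3; (A9) [x1,x1]=x4, [x1,x2]=x3, [x2,x1]=−x3, [x2,x2]=x4. -/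
noncomputable section

/-- If the square of a Leibniz algebra is two-sided central, the bracket only depends on the
coordinates modulo the square. -/
theorem bracket_add_central {A : Type*} [AddCommGroup A] [Module ℂ A]
    (β : A →ₗ[ℂ] A →ₗ[ℂ] A) (hc : ∀ m ∈ lpow β 2, ∀ a, β m a = 0 ∧ β a m = 0)
    (u v : A) (s t s' t' : ℂ) {m n : A} (hm : m ∈ lpow β 2) (hn : n ∈ lpow β 2) :
    β (s • u + t • v + m) (s' • u + t' • v + n) =
      (s * s') • β u u + (s * t') • β u v + (t * s') • β v u + (t * t') • β v v := by
  simp only [map_add, map_smul, LinearMap.add_apply, LinearMap.smul_apply, (hc m hm _).1,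
    (hc n hn _).2]
  module

theorem bracket_mem_lpow_two {A : Type*} [AddCommGroup A] [Module ℂ A]
    (β : A →ₗ[ℂ] A →ₗ[ℂ] A) (a b : A) : β a b ∈ lpow β 2 :=
  Submodule.subset_span ⟨a, b, Submodule.mem_top, rfl⟩

/-- When `A³ = 0`, the square `A²` lies in the two-sided center. -/
theorem lpow_two_central {A : Type*} [AddCommGroup A] [Module ℂ A]
    (β : A →ₗ[ℂ] A →ₗ[ℂ] A) (hleib : IsLeibniz β) (h3 : lpow β 3 = ⊥) :
    ∀ m ∈ lpow β 2, ∀ a, β m a = 0 ∧ β a m = 0 := by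
  have hr : ∀ m ∈ lpow β 2, ∀ a, β a m = 0 := fun m hm a => by
    have h : β a m ∈ lpow β 3 := Submodule.subset_span ⟨a, m, hm, rfl⟩
    rwa [h3, Submodule.mem_bot] at h
  refine fun m hm a => ⟨?_, hr m hm a⟩
  have hle : lpow β 2 ≤ LinearMap.ker (β.flip a) := by
    refine Submodule.span_le.2 ?_
    rintro _ ⟨b, c, -, rfl⟩
    have h := hleib b c a
    rw [hr _ (bracket_mem_lpow_two β c a), hr _ (bracket_mem_lpow_two β b a), add_zero] at h
    simpa using h.symm
  simpa using hle hm

/-- The algebra with products `[x₁, x₁] = x₄`, `[x₁, x₂] = x₃`, `[x₂, x₁] = -x₃`,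
`[x₂, x₂] = ε x₄`. -/
def diagonalConstants (ε : ℂ) : Fin 4 → Fin 4 → Fin 4 → ℂ :=
  ![![E 3, E 2, 0, 0], ![-E 2, ε • E 3, 0, 0], 0, 0]

theorem leibIso_diagonal {A : Type*} [AddCommGroup A] [Module ℂ A]
    (β : A →ₗ[ℂ] A →ₗ[ℂ] A) (hdim : Module.finrank ℂ A = 4)
    (hc : ∀ m ∈ lpow β 2, ∀ a, β m a = 0 ∧ β a m = 0) (u v : A)
    (hgen : ∀ a, ∃ s t : ℂ, ∃ m ∈ lpow β 2, a = s • u + t • v + m)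
    (ε : ℂ) (hvu : β v u = -β u v) (hvv : β v v = ε • β u u) :
    LeibIso β (mkBil (diagonalConstants ε)) := by
  have : FiniteDimensional ℂ A := Module.finite_of_finrank_pos (by omega)
  let f : (Fin 4 → ℂ) →ₗ[ℂ] A := Fintype.linearCombination ℂ ![u, v, β u v, β u u]
  have hf : ∀ x, f x = x 0 • u + x 1 • v + x 2 • β u v + x 3 • β u u := fun x => by
    simp [f, Fintype.linearCombination_apply, Fin.sum_univ_four]
  have hle : lpow β 2 ≤ LinearMap.range f := by
    refine Submodule.span_le.2 ?_
    rintro _ ⟨a, b, -, rfl⟩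
    obtain ⟨s, t, m, hm, rfl⟩ := hgen a
    obtain ⟨s', t', n, hn, rfl⟩ := hgen b
    refine ⟨![0, 0, s * t' - t * s', s * s' + t * t' * ε], ?_⟩
    rw [bracket_add_central β hc u v s t s' t' hm hn, hf, hvu, hvv]
    simp
    module
  have hsurj : Function.Surjective f := fun a => by
    obtain ⟨s, t, m, hm, rfl⟩ := hgen a
    obtain ⟨x, rfl⟩ := hle hm
    refine ⟨![s, t, 0, 0] + x, ?_⟩
    rw [map_add, hf ![s, t, 0, 0]]
    simp
  have hinj : Function.Injective f :=
    (LinearMap.injective_iff_surjective_of_finrank_eq_finrank (by simp [hdim])).2 hsurj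
  let e := LinearEquiv.ofBijective f ⟨hinj, hsurj⟩
  have hmul : ∀ x y, f (mkBil (diagonalConstants ε) x y) = β (f x) (f y) := fun x y => by
    have hmem : ∀ x : Fin 4 → ℂ, x 2 • β u v + x 3 • β u u ∈ lpow β 2 := fun x =>
      add_mem (Submodule.smul_mem _ _ (bracket_mem_lpow_two β u v))
        (Submodule.smul_mem _ _ (bracket_mem_lpow_two β u u))
    rw [hf x, hf y, add_assoc (_ + _), add_assoc (y 0 • u + y 1 • v),
      bracket_add_central β hc u v _ _ _ _ (hmem x) (hmem y), hf, hvu, hvv]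
    simp [mkBil, diagonalConstants, E, Fin.sum_univ_four]
    module
  refine ⟨e.symm, fun x y => ?_⟩
  rw [LinearEquiv.symm_apply_eq]
  change _ = f _
  rw [hmul]
  exact congrArg₂ (fun a b => β a b) (e.apply_symm_apply x).symm (e.apply_symm_apply y).symm

theorem leibIso_of_sq_ne_zero {A : Type*} [AddCommGroup A] [Module ℂ A]
    (β : A →ₗ[ℂ] A →ₗ[ℂ] A) (hdim : Module.finrank ℂ A = 4)
    (hc : ∀ m ∈ lpow β 2, ∀ a, β m a = 0 ∧ β a m = 0) (u v z : A)
    (hgen : ∀ a, ∃ s t : ℂ, ∃ m ∈ lpow β 2, a = s • u + t • v + m)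
    (p q r : ℂ) (hp : p ≠ 0) (huu : β u u = p • z) (hsym : β u v + β v u = (2 * q) • z)
    (hvv : β v v = r • z) :
    LeibIso β (mkBil sA8) ∨ LeibIso β (mkBil sA9) := by
  have h8 : diagonalConstants 0 = sA8 := by simp [diagonalConstants, sA8]
  have h9 : diagonalConstants 1 = sA9 := by simp [diagonalConstants, sA9]
  have hvu : β v u = (2 * q) • z - β u v := by rw [← hsym]; abel
  rw [← h8, ← h9]
  have key : ∀ c ε : ℂ, c ≠ 0 → c ^ 2 * (r - q ^ 2 / p) = ε * p →
      LeibIso β (mkBil (diagonalConstants ε)) := by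
    intro c ε hc0 hcε
    refine leibIso_diagonal β hdim hc u (c • (v - (q / p) • u)) (fun a => ?_) ε ?_ ?_
    · obtain ⟨s, t, m, hm, rfl⟩ := hgen a
      refine ⟨s + t * (q / p), t / c, m, hm, ?_⟩
      rw [smul_smul, div_mul_cancel₀ t hc0]
      module
    · simp only [map_sub, map_smul, LinearMap.sub_apply, LinearMap.smul_apply, huu, hvu]
      match_scalars
      · field_simp
        ring
      · ring
    · simp only [map_sub, map_smul, LinearMap.sub_apply, LinearMap.smul_apply, huu, hvu, hvv]
      match_scalars
      · rw [mul_one p, ← hcε]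
        field_simp
        ring
      · ring
  by_cases hδ : r - q ^ 2 / p = 0
  · exact Or.inl (key 1 0 one_ne_zero (by simp [hδ]))
  · obtain ⟨c, hcc⟩ := IsAlgClosed.exists_pow_nat_eq (p / (r - q ^ 2 / p)) (n := 2) (by norm_num)
    refine Or.inr (key c 1 ?_ (by rw [hcc, div_mul_cancel₀ _ hδ, one_mul]))
    rintro rfl
    exact div_ne_zero hp hδ (by simpa using hcc.symm)

/-- Classification with `dim A² = 2`, `dim A³ = 0`, `dim Leib(A) = 1`. -/
theorem four_dim_nilpotent_dimAsq_two_dimAcube_zero_leib_one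
    {A : Type*} [AddCommGroup A] [Module ℂ A]
    (β : A →ₗ[ℂ] A →ₗ[ℂ] A) (hleib : IsLeibniz β)
    (hdim : Module.finrank ℂ A = 4)
    (hnonsplit : ¬ LeibIsSplit β)
    (hnonlie : leibSpan β ≠ ⊥)
    (hnilp : LeibNilpotent β)
    (hA2 : Module.finrank ℂ (lpow β 2) = 2)
    (hA3 : Module.finrank ℂ (lpow β 3) = 0)
    (hLeib : Module.finrank ℂ (leibSpan β) = 1) :
    LeibIso β (mkBil sA8) ∨ LeibIso β (mkBil sA9) := by
  have : FiniteDimensional ℂ A := Module.finite_of_finrank_pos (by omega)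
  have hc := lpow_two_central β hleib (Submodule.finrank_eq_zero.1 hA3)
  obtain ⟨⟨z, hz⟩, -, hzspan⟩ := finrank_eq_one_iff'.1 hLeib
  have hsq : ∀ a, ∃ k : ℂ, β a a = k • z := fun a => by
    obtain ⟨k, hk⟩ := hzspan ⟨β a a, Submodule.subset_span ⟨a, rfl⟩⟩
    exact ⟨k, (congrArg Subtype.val hk).symm⟩
  obtain ⟨C, hC⟩ := Submodule.exists_isCompl (lpow β 2)
  have hCdim : Module.finrank ℂ C = 2 := by
    have := Submodule.finrank_add_eq_of_isCompl hC
    omega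
  let b := Module.finBasisOfFinrankEq ℂ C hCdim
  have hgen : ∀ a, ∃ s t : ℂ, ∃ m ∈ lpow β 2, a = s • (b 0 : A) + t • (b 1 : A) + m := fun a => by
    obtain ⟨m, hm, x, hx, rfl⟩ := Submodule.mem_sup.1 (hC.sup_eq_top ▸ Submodule.mem_top (x := a))
    refine ⟨b.repr ⟨x, hx⟩ 0, b.repr ⟨x, hx⟩ 1, m, hm, ?_⟩
    have h := congrArg Subtype.val (b.sum_repr ⟨x, hx⟩)
    rw [Fin.sum_univ_two] at h
    rw [add_comm m x]
    exact congrArg (· + m) h.symm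
  generalize (b 0 : A) = u at hgen
  generalize (b 1 : A) = v at hgen
  obtain ⟨p, hp⟩ := hsq u
  obtain ⟨r, hr⟩ := hsq v
  obtain ⟨k, hk⟩ := hsq (u + v)
  have hsym : β u v + β v u = (2 * ((k - p - r) / 2)) • z := by
    simp only [map_add, LinearMap.add_apply, hp, hr] at hk
    calc β u v + β v u = (p • z + β v u + (β u v + r • z)) - p • z - r • z := by abel
      _ = _ := by rw [hk]; module
  by_cases hp0 : p = 0
  · by_cases hr0 : r = 0
    · by_cases hk0 : k = 0
      · refine absurd (Submodule.span_eq_bot.2 ?_) hnonlie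
        rintro _ ⟨a, rfl⟩
        obtain ⟨s, t, m, hm, rfl⟩ := hgen a
        have h0 : β v u = -β u v := by
          rw [eq_neg_iff_add_eq_zero, add_comm, hsym, hp0, hr0, hk0]
          simp
        rw [bracket_add_central β hc u v s t s t hm hm, hp, hr, h0, hp0, hr0]
        module
      · refine leibIso_of_sq_ne_zero β hdim hc (u + v) v z (fun a => ?_) k (k / 2) r hk0 hk ?_ hr
        · obtain ⟨s, t, m, hm, rfl⟩ := hgen a
          exact ⟨s, t - s, m, hm, by module⟩
        · simp only [map_add, LinearMap.add_apply]
          rw [hr, hr0, add_add_add_comm, hsym, hp0, hr0]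
          module
    · refine leibIso_of_sq_ne_zero β hdim hc v u z (fun a => ?_) r _ p hr0 hr
        ((add_comm _ _).trans hsym) hp
      obtain ⟨s, t, m, hm, rfl⟩ := hgen a
      exact ⟨t, s, m, hm, by rw [add_comm (s • u)]⟩
  · exact leibIso_of_sq_ne_zero β hdim hc u v z hgen p _ r hp0 hp hsym hr
end
end

section
/- Let A be a 4-dimensional non-split non-Lie nilpotent Leibniz algebra over ℂ with dim A² = 2 = dim Leib(A) and dim A³ = 1. Then A is isomorphic to the Leibniz algebra with basis {x1,x2,x3,x4} whose nonzero products are given by one of the following: (A20) [x1,x2]=x3, [x1,x3]=x4; (A21) [x1,x2]=x3, [x2,x2]=x4, [x1,x3]=x4; (A22) [x1,x2]=x3, [x2,x1]=x4, [x1,x3]=x4; (A23) [x1,x2]=x3, [x2,x1]=x4, [x2,x2]=x4, [x1,x3]=x4; (A24) [x1,x1]=x3, [x2,x1]=x4, [x1,x3]=x4; (A25) [x1,x1]=x3, [x2,x2]=x4, [x1,x3]=x4. -/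
noncomputable section

section

variable {A : Type*} [AddCommGroup A] [Module ℂ A]

/-- A basis with the prescribed structure constants yields an isomorphism with `mkBil f`. -/
lemma leibIso_mkBil_of_basis {β : A →ₗ[ℂ] A →ₗ[ℂ] A} (v : Module.Basis (Fin 4) ℂ A)
    (f : Fin 4 → Fin 4 → Fin 4 → ℂ) (h : ∀ i j, β (v i) (v j) = ∑ k, f i j k • v k) :
    LeibIso β (mkBil f) := by
  refine ⟨v.equivFun, fun x y => ?_⟩
  have hf : ∀ i j, v.equivFun (β (v i) (v j)) = f i j := fun i j => by
    rw [h, ← v.equivFun_symm_apply, LinearEquiv.apply_symm_apply]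
  conv_lhs => rw [← v.sum_equivFun x, ← v.sum_equivFun y]
  simp only [map_sum, map_smul, LinearMap.sum_apply, LinearMap.smul_apply, hf, mkBil,
    LinearMap.mk₂_apply, Finset.smul_sum, smul_smul]
  rw [Finset.sum_comm]
  simp only [mul_comm]

lemma bilin_mem_of_basis {β : A →ₗ[ℂ] A →ₗ[ℂ] A} (v : Module.Basis (Fin 4) ℂ A)
    {S : Submodule ℂ A} (h : ∀ i j, β (v i) (v j) ∈ S) (a b : A) : β a b ∈ S := by
  rw [← v.sum_equivFun a, ← v.sum_equivFun b]
  simp only [map_sum, map_smul, LinearMap.sum_apply, LinearMap.smul_apply]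
  exact S.sum_mem fun i _ => S.smul_mem _ (S.sum_mem fun j _ => S.smul_mem _ (h _ _))

/-- Four vectors that are triangular with respect to a basis, with nonzero diagonal, form a
basis. -/
lemma exists_basis_of_triangular (v : Module.Basis (Fin 4) ℂ A) {d₀ d₁ d₂ d₃ : ℂ}
    (h₀ : d₀ ≠ 0) (h₁ : d₁ ≠ 0) (h₂ : d₂ ≠ 0) (h₃ : d₃ ≠ 0) (a₁ a₂ a₃ b₂ b₃ c₃ : ℂ) :
    ∃ u : Module.Basis (Fin 4) ℂ A,
      u 0 = d₀ • v 0 + a₁ • v 1 + a₂ • v 2 + a₃ • v 3 ∧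
      u 1 = d₁ • v 1 + b₂ • v 2 + b₃ • v 3 ∧ u 2 = d₂ • v 2 + c₃ • v 3 ∧ u 3 = d₃ • v 3 := by
  let u : Fin 4 → A := ![d₀ • v 0 + a₁ • v 1 + a₂ • v 2 + a₃ • v 3,
    d₁ • v 1 + b₂ • v 2 + b₃ • v 3, d₂ • v 2 + c₃ • v 3, d₃ • v 3]
  have hu : LinearIndependent ℂ u := by
    refine Fintype.linearIndependent_iff.2 fun g hg => ?_
    have hv := Fintype.linearIndependent_iff.1 v.linearIndependent
      ![g 0 * d₀, g 0 * a₁ + g 1 * d₁, g 0 * a₂ + g 1 * b₂ + g 2 * d₂,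
        g 0 * a₃ + g 1 * b₃ + g 2 * c₃ + g 3 * d₃] (by
          rw [← hg]
          simp only [u, Fin.sum_univ_four, Matrix.cons_val]
          module)
    have e₀ := hv 0
    have e₁ := hv 1
    have e₂ := hv 2
    have e₃ := hv 3
    simp only [Matrix.cons_val] at e₀ e₁ e₂ e₃
    have g₀ : g 0 = 0 := by simpa [h₀] using e₀
    have g₁ : g 1 = 0 := by simpa [h₁, g₀] using e₁
    have g₂ : g 2 = 0 := by simpa [h₂, g₀, g₁] using e₂
    have g₃ : g 3 = 0 := by simpa [h₃, g₀, g₁, g₂] using e₃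
    intro i
    fin_cases i <;> assumption
  have hcard : Fintype.card (Fin 4) = Module.finrank ℂ A := by
    rw [Module.finrank_eq_card_basis v]
  refine ⟨basisOfLinearIndependentOfCardEqFinrank hu hcard, ?_⟩
  simp only [coe_basisOfLinearIndependentOfCardEqFinrank]
  exact ⟨rfl, rfl, rfl, rfl⟩

/-- The multiplication table shared by all algebras under consideration. -/
structure ReducedTable (β : A →ₗ[ℂ] A →ₗ[ℂ] A) (v : Module.Basis (Fin 4) ℂ A)
    (p q r s b c : ℂ) : Prop where
  h00 : β (v 0) (v 0) = p • v 2 + q • v 3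
  h01 : β (v 0) (v 1) = r • v 2 + s • v 3
  h10 : β (v 1) (v 0) = b • v 3
  h11 : β (v 1) (v 1) = c • v 3
  h02 : β (v 0) (v 2) = v 3
  h12 : β (v 1) (v 2) = 0
  h03 : β (v 0) (v 3) = 0
  h13 : β (v 1) (v 3) = 0
  left2 : β (v 2) = 0
  left3 : β (v 3) = 0

namespace ReducedTable

variable {β : A →ₗ[ℂ] A →ₗ[ℂ] A} {v : Module.Basis (Fin 4) ℂ A} {p q r s b c : ℂ}

lemma leibIso_of_ne_zero (h : ReducedTable β v p q r s b c) (hr : r ≠ 0) {σ t ε δ : ℂ}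
    (hσ : σ ≠ 0) (ht : t ≠ 0) (hε : b - p / r * c = ε * σ * r) (hδ : t * c = δ * σ ^ 2 * r) :
    LeibIso β (mkBil ![![0, E 2, E 3, 0], ![ε • E 3, δ • E 3, 0, 0], 0, 0]) := by
  obtain ⟨k, hk⟩ : ∃ k, k = -(p / r) := ⟨_, rfl⟩
  have hkr : p + k * r = 0 := by rw [hk]; field_simp; ring
  have hε' : b + k * c = ε * σ * r := by rw [← hε, hk]; ring
  obtain ⟨m, hm⟩ : ∃ m, m = -(q + k * s + k * b + k ^ 2 * c) := ⟨_, rfl⟩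
  obtain ⟨u, u0, u1, u2, u3⟩ := exists_basis_of_triangular v hσ ht
    (mul_ne_zero (mul_ne_zero hσ ht) hr) (mul_ne_zero (mul_ne_zero (pow_ne_zero 2 hσ) ht) hr)
    (σ * k) (σ * m) 0 0 0 (σ * t * (s + k * c))
  refine leibIso_mkBil_of_basis u _ fun i j => ?_
  have key00 : β (u 0) (u 0) = 0 := by
    simp only [u0, map_add, map_smul, LinearMap.add_apply, LinearMap.smul_apply, h.h00, h.h01,
      h.h10, h.h11, h.h02, h.h12, h.h03, h.h13, h.left2, h.left3, LinearMap.zero_apply, hm]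
    linear_combination (norm := module) (σ ^ 2 * hkr) • v 2
  have key01 : β (u 0) (u 1) = u 2 := by
    simp only [u0, u1, u2, map_add, map_smul, LinearMap.add_apply, LinearMap.smul_apply,
      h.h01, h.h11, h.h02, h.h12, h.h03, h.h13, h.left2, h.left3, LinearMap.zero_apply]
    module
  have key02 : β (u 0) (u 2) = u 3 := by
    simp only [u0, u2, u3, map_add, map_smul, LinearMap.add_apply, LinearMap.smul_apply,
      h.h02, h.h12, h.h03, h.h13, h.left2, h.left3, LinearMap.zero_apply]
    module
  have key10 : β (u 1) (u 0) = ε • u 3 := by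
    simp only [u0, u1, u3, map_add, map_smul, LinearMap.add_apply, LinearMap.smul_apply,
      h.h10, h.h11, h.h12, h.h13, h.left2, h.left3, LinearMap.zero_apply]
    linear_combination (norm := module) (t * σ * hε') • v 3
  have key11 : β (u 1) (u 1) = δ • u 3 := by
    simp only [u1, u3, map_add, map_smul, LinearMap.add_apply, LinearMap.smul_apply,
      h.h11, h.h12, h.h13, h.left2, h.left3, LinearMap.zero_apply]
    linear_combination (norm := module) (t * hδ) • v 3
  have key03 : β (u 0) (u 3) = 0 := by simp [u0, u3, h.h03, h.h13, h.left2]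
  have key12 : β (u 1) (u 2) = 0 := by simp [u1, u2, h.h12, h.h13]
  have key13 : β (u 1) (u 3) = 0 := by simp [u1, u3, h.h13]
  have left2 : β (u 2) = 0 := by simp [u2, h.left2, h.left3]
  have left3 : β (u 3) = 0 := by simp [u3, h.left3]
  fin_cases i <;> fin_cases j <;>
    simp [Fin.sum_univ_four, E, key00, key01, key02, key03, key10, key11, key12, key13,
      left2, left3]

lemma leibIso_of_eq_zero (h : ReducedTable β v p q 0 s b c) (hp : p ≠ 0) {k t ε δ : ℂ}
    (ht : t ≠ 0) (hε : t * (b + k * c) = ε * p) (hδ : t ^ 2 * c = δ * p) :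
    LeibIso β (mkBil ![![E 2, 0, E 3, 0], ![ε • E 3, δ • E 3, 0, 0], 0, 0]) := by
  obtain ⟨u, u0, u1, u2, u3⟩ := exists_basis_of_triangular v one_ne_zero ht hp hp
    k 0 0 (-t * (s + k * c)) 0 (q + k * s + k * b + k ^ 2 * c)
  refine leibIso_mkBil_of_basis u _ fun i j => ?_
  have key00 : β (u 0) (u 0) = u 2 := by
    simp only [u0, u2, map_add, map_smul, LinearMap.add_apply, LinearMap.smul_apply, h.h00, h.h01,
      h.h10, h.h11, h.h02, h.h12, h.h03, h.h13, h.left2, h.left3, LinearMap.zero_apply]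
    module
  have key01 : β (u 0) (u 1) = 0 := by
    simp only [u0, u1, map_add, map_smul, LinearMap.add_apply, LinearMap.smul_apply,
      h.h01, h.h11, h.h02, h.h12, h.h03, h.h13, h.left2, h.left3, LinearMap.zero_apply]
    module
  have key02 : β (u 0) (u 2) = u 3 := by
    simp only [u0, u2, u3, map_add, map_smul, LinearMap.add_apply, LinearMap.smul_apply,
      h.h02, h.h12, h.h03, h.h13, h.left2, h.left3, LinearMap.zero_apply]
    module
  have key10 : β (u 1) (u 0) = ε • u 3 := by
    simp only [u0, u1, u3, map_add, map_smul, LinearMap.add_apply, LinearMap.smul_apply,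
      h.h10, h.h11, h.h12, h.h13, h.left2, h.left3, LinearMap.zero_apply]
    linear_combination (norm := module) hε • v 3
  have key11 : β (u 1) (u 1) = δ • u 3 := by
    simp only [u1, u3, map_add, map_smul, LinearMap.add_apply, LinearMap.smul_apply,
      h.h11, h.h12, h.h13, h.left2, h.left3, LinearMap.zero_apply]
    linear_combination (norm := module) hδ • v 3
  have key03 : β (u 0) (u 3) = 0 := by simp [u0, u3, h.h03, h.h13]
  have key12 : β (u 1) (u 2) = 0 := by simp [u1, u2, h.h12, h.h13, h.left2]
  have key13 : β (u 1) (u 3) = 0 := by simp [u1, u3, h.h13, h.left2]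
  have left2 : β (u 2) = 0 := by simp [u2, h.left2, h.left3]
  have left3 : β (u 3) = 0 := by simp [u3, h.left3]
  fin_cases i <;> fin_cases j <;>
    simp [Fin.sum_univ_four, E, key00, key01, key02, key03, key10, key11, key12, key13,
      left2, left3]

lemma isSplit (h : ReducedTable β v p q 0 s 0 0) : LeibIsSplit β := by
  obtain ⟨u, u0, u1, u2, u3⟩ := exists_basis_of_triangular v one_ne_zero one_ne_zero one_ne_zero
    one_ne_zero 0 0 0 (-s) 0 0
  simp only [one_smul, zero_smul, add_zero] at u0 u1 u2 u3
  have hL : β (u 1) = 0 := v.ext fun i => by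
    fin_cases i <;> simp [u1, h.h10, h.h11, h.h12, h.h13, h.left2]
  have hR : ∀ a, β a (u 1) = 0 := fun a => by
    have : β.flip (u 1) = 0 := v.ext fun i => by
      fin_cases i <;> simp [u1, h.h01, h.h11, h.h02, h.h12, h.left2, h.left3]
    simpa using LinearMap.congr_fun this a
  have hmem : ∀ a b, β a b ∈ Submodule.span ℂ (u '' {0, 2, 3}) := by
    have m2 : v 2 ∈ Submodule.span ℂ (u '' {0, 2, 3}) :=
      Submodule.subset_span ⟨2, by simp, u2⟩
    have m3 : v 3 ∈ Submodule.span ℂ (u '' {0, 2, 3}) :=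
      Submodule.subset_span ⟨3, by simp, u3⟩
    refine bilin_mem_of_basis v fun i j => ?_
    fin_cases i <;> fin_cases j <;>
      simp [h.h00, h.h01, h.h10, h.h11, h.h02, h.h12, h.h03, h.h13, h.left2, h.left3, m2, m3,
        Submodule.add_mem, Submodule.smul_mem]
  refine ⟨Submodule.span ℂ {u 1}, Submodule.span ℂ (u '' {0, 2, 3}), ?_,
    fun x _ a => ⟨hmem _ _, hmem _ _⟩, ?_, ?_, ?_, ?_⟩
  · intro x hx a
    obtain ⟨k, rfl⟩ := Submodule.mem_span_singleton.1 hx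
    simp [hL, hR]
  · simpa using u.ne_zero 1
  · rw [Submodule.ne_bot_iff]
    exact ⟨u 0, Submodule.subset_span ⟨0, by simp, rfl⟩, u.ne_zero 0⟩
  · rw [← disjoint_iff, ← Set.image_singleton]
    exact u.linearIndependent.disjoint_span_image (by simp)
  · rw [← Submodule.span_union, ← Set.image_singleton, ← Set.image_union, eq_top_iff, ← u.span_eq]
    refine Submodule.span_mono ?_
    rintro _ ⟨i, rfl⟩
    exact ⟨i, by fin_cases i <;> simp, rfl⟩

end ReducedTable

lemma lpow_succ_le (β : A →ₗ[ℂ] A →ₗ[ℂ] A) (n : ℕ) : lpow β (n + 1) ≤ lpow β n := by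
  induction n with
  | zero => exact le_top
  | succ n ih =>
    cases n with
    | zero => exact le_top
    | succ n =>
      refine Submodule.span_mono ?_
      rintro _ ⟨a, b, hb, rfl⟩
      exact ⟨a, b, ih hb, rfl⟩

lemma apply_mem_lpow {β : A →ₗ[ℂ] A →ₗ[ℂ] A} {n : ℕ} (a : A) {b : A} (hb : b ∈ lpow β (n + 1)) :
    β a b ∈ lpow β (n + 2) :=
  Submodule.subset_span ⟨a, b, hb, rfl⟩

/-- In a nilpotent algebra the lower central series decreases strictly until it vanishes. -/
lemma lpow_eq_bot_of_succ_eq {β : A →ₗ[ℂ] A →ₗ[ℂ] A} (hnilp : LeibNilpotent β) {n : ℕ}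
    (h : lpow β (n + 2) = lpow β (n + 1)) : lpow β (n + 1) = ⊥ := by
  obtain ⟨N, hN⟩ := hnilp
  have hstable : ∀ k, lpow β (n + 1 + k) = lpow β (n + 1) := by
    intro k
    induction k with
    | zero => rfl
    | succ k ih =>
      rw [← h, show n + 1 + (k + 1) = (n + k) + 2 by ring]
      change bracketSpan β (lpow β (n + k + 1)) = bracketSpan β (lpow β (n + 1))
      rw [show n + k + 1 = n + 1 + k by ring, ih]
  have hanti : Antitone (lpow β) := antitone_nat_of_succ_le (lpow_succ_le β)
  rw [← hstable N, eq_bot_iff, ← hN]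
  exact hanti (by omega)

lemma IsLeibniz.apply_leibSpan {β : A →ₗ[ℂ] A →ₗ[ℂ] A} (hleib : IsLeibniz β) {u : A}
    (hu : u ∈ leibSpan β) : β u = 0 := by
  have : leibSpan β ≤ LinearMap.ker β := by
    refine Submodule.span_le.2 ?_
    rintro _ ⟨a, rfl⟩
    refine LinearMap.ext fun c => ?_
    simpa using hleib a a c
  exact this hu

lemma leibSpan_le_lpow_two (β : A →ₗ[ℂ] A →ₗ[ℂ] A) : leibSpan β ≤ lpow β 2 := by
  refine Submodule.span_mono ?_
  rintro _ ⟨a, rfl⟩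
  exact ⟨a, a, trivial, rfl⟩

lemma exists_reducedTable {β : A →ₗ[ℂ] A →ₗ[ℂ] A} (hleib : IsLeibniz β)
    (hdim : Module.finrank ℂ A = 4) (hnilp : LeibNilpotent β)
    (hA2 : Module.finrank ℂ (lpow β 2) = 2) (hLeib : Module.finrank ℂ (leibSpan β) = 2)
    (hA3 : Module.finrank ℂ (lpow β 3) = 1) :
    ∃ (v : Module.Basis (Fin 4) ℂ A) (p q r s b c : ℂ),
      ReducedTable β v p q r s b c ∧ (r = 0 → p ≠ 0) := by
  have : FiniteDimensional ℂ A := Module.finite_of_finrank_pos (by omega)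
  have hL : leibSpan β = lpow β 2 :=
    Submodule.eq_of_le_of_finrank_eq (leibSpan_le_lpow_two β) (by omega)
  have hleft : ∀ {u}, u ∈ lpow β 2 → β u = 0 := fun hu => hleib.apply_leibSpan (hL ▸ hu)
  have hA3ne : lpow β 3 ≠ ⊥ := by
    intro h
    rw [h, finrank_bot] at hA3
    exact zero_ne_one hA3
  have hA4 : lpow β 4 = ⊥ := by
    by_contra hne
    refine hA3ne (lpow_eq_bot_of_succ_eq hnilp (Submodule.eq_of_le_of_finrank_le
      (lpow_succ_le β 3) ?_))
    exact hA3.trans_le (Submodule.one_le_finrank_iff.2 hne)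
  obtain ⟨x, y, hy, hw⟩ : ∃ x, ∃ y ∈ lpow β 2, β x y ≠ 0 := by
    by_contra! hall
    refine hA3ne (eq_bot_iff.2 (Submodule.span_le.2 ?_))
    rintro _ ⟨a, b, hb, rfl⟩
    exact hall a b hb
  obtain ⟨w, hwdef⟩ : ∃ w, w = β x y := ⟨_, rfl⟩
  rw [← hwdef] at hw
  have hw3 : w ∈ lpow β 3 := hwdef ▸ apply_mem_lpow x hy
  have hw2 : w ∈ lpow β 2 := lpow_succ_le β 2 hw3
  have hkill : ∀ a, ∀ {u}, u ∈ lpow β 3 → β a u = 0 := fun a u hu => by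
    have := apply_mem_lpow a hu
    rwa [hA4, Submodule.mem_bot] at this
  have hspan : ∀ u ∈ lpow β 3, ∃ k : ℂ, k • w = u := by
    intro u hu
    obtain ⟨k, hk⟩ := (finrank_eq_one_iff_of_nonzero' (⟨w, hw3⟩ : lpow β 3)
      (by simpa using hw)).1 hA3 ⟨u, hu⟩
    exact ⟨k, congrArg Subtype.val hk⟩
  obtain ⟨z, hz2, hzy⟩ : ∃ z, z ∉ lpow β 2 ∧ β z y = 0 := by
    obtain ⟨a, ha⟩ : ∃ a, a ∉ lpow β 2 ⊔ Submodule.span ℂ {x} := by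
      by_contra! hall
      have htop : lpow β 2 ⊔ Submodule.span ℂ {x} = ⊤ := Submodule.eq_top_iff'.2 hall
      have h1 := Submodule.finrank_add_le_finrank_add_finrank (lpow β 2) (Submodule.span ℂ {x})
      rw [htop, finrank_top] at h1
      have h2 := finrank_span_le_card (R := ℂ) {x}
      rw [Set.toFinset_singleton, Finset.card_singleton] at h2
      omega
    obtain ⟨k, hk⟩ := hspan (β a y) (apply_mem_lpow a hy)
    refine ⟨a - k • x, fun hmem => ha ?_, by simp [← hk, hwdef]⟩
    rw [← sub_add_cancel a (k • x)]
    exact Submodule.add_mem_sup hmem (Submodule.smul_mem _ _ (Submodule.mem_span_singleton_self x))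
  have hcoeff : ∀ k l : ℂ, k • x + l • z ∈ lpow β 2 → k = 0 ∧ l = 0 := by
    intro k l h
    have hk : k = 0 := by
      have := LinearMap.congr_fun (hleft h) y
      simpa [hzy, ← hwdef, hw] using this
    refine ⟨hk, ?_⟩
    by_contra hl
    rw [hk, zero_smul, zero_add] at h
    exact hz2 ((Submodule.smul_mem_iff _ hl).1 h)
  have hli : LinearIndependent ℂ ![x, z, y, w] := by
    refine Fintype.linearIndependent_iff.2 fun g hg => ?_
    simp only [Fin.sum_univ_four, Matrix.cons_val] at hg
    obtain ⟨g0, g1⟩ := hcoeff (g 0) (g 1) (by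
      rw [show g 0 • x + g 1 • z = -(g 2 • y + g 3 • w) by
        linear_combination (norm := module) hg]
      exact neg_mem (add_mem (Submodule.smul_mem _ _ hy) (Submodule.smul_mem _ _ hw2)))
    have g2 : g 2 = 0 := by
      have := congrArg (β x) hg
      simpa [g0, g1, ← hwdef, hkill x hw3, hw] using this
    have g3 : g 3 = 0 := by simpa [g0, g1, g2, hw] using hg
    intro i
    fin_cases i <;> assumption
  let v := basisOfLinearIndependentOfCardEqFinrank hli (by simp [hdim])
  have v0 : v 0 = x := by simp [v]
  have v1 : v 1 = z := by simp [v]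
  have v2 : v 2 = y := by simp [v]
  have v3 : v 3 = w := by simp [v]
  have hA2span : ∀ u ∈ lpow β 2, ∃ k l : ℂ, u = k • y + l • w := by
    intro u hu
    have hsum := v.sum_equivFun u
    rw [Fin.sum_univ_four, v0, v1, v2, v3] at hsum
    obtain ⟨e0, e1⟩ := hcoeff (v.equivFun u 0) (v.equivFun u 1) (by
      rw [show v.equivFun u 0 • x + v.equivFun u 1 • z =
          u - (v.equivFun u 2 • y + v.equivFun u 3 • w) by
        linear_combination (norm := module) hsum]
      exact sub_mem hu (add_mem (Submodule.smul_mem _ _ hy) (Submodule.smul_mem _ _ hw2)))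
    refine ⟨v.equivFun u 2, v.equivFun u 3, ?_⟩
    rw [e0, e1, zero_smul, zero_smul, zero_add, zero_add] at hsum
    exact hsum.symm
  have hmem : ∀ a b, β a b ∈ lpow β 2 := fun a b => apply_mem_lpow (n := 0) a trivial
  have hz : ∀ a, ∃ k : ℂ, β z a = k • w := by
    intro a
    obtain ⟨k, l, hkl⟩ := hA2span _ (hmem z a)
    obtain ⟨k', l', hkl'⟩ := hA2span _ (hmem x a)
    have h := hleib x z a
    rw [hleft (hmem x z), hkl, hkl'] at h
    have hk : k = 0 := by simpa [← hwdef, hkill _ hw3, hzy, hw] using h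
    exact ⟨l, by rw [hkl, hk, zero_smul, zero_add]⟩
  obtain ⟨p, q, hxx⟩ := hA2span _ (hmem x x)
  obtain ⟨r, s, hxz⟩ := hA2span _ (hmem x z)
  obtain ⟨b, hzx⟩ := hz x
  obtain ⟨c, hzz⟩ := hz z
  refine ⟨v, p, q, r, s, b, c, ?_, ?_⟩
  · constructor <;> simp only [v0, v1, v2, v3]
    exacts [hxx, hxz, hzx, hzz, hwdef.symm, hzy, hkill _ hw3, hkill _ hw3, hleft hy, hleft hw2]
  · rintro rfl rfl
    have hle : lpow β 2 ≤ Submodule.span ℂ {w} := by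
      refine Submodule.span_le.2 ?_
      rintro _ ⟨a, a', -, rfl⟩
      refine bilin_mem_of_basis v (fun i j => ?_) a a'
      have hself := Submodule.mem_span_singleton_self (R := ℂ) w
      fin_cases i <;> fin_cases j <;>
        simp [v0, v1, v2, v3, hxx, hxz, hzx, hzz, ← hwdef, hzy, hkill _ hw3, hleft hy,
          hleft hw2, hself, Submodule.smul_mem]
    have h1 := Submodule.finrank_mono hle
    have h2 := finrank_span_singleton (K := ℂ) hw
    omega

end

/-- Classification with `dim A² = 2 = dim Leib(A)` and `dim A³ = 1`. -/
theorem four_dim_nilpotent_dimAsq_two_leib_two_dimAcube_one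
    {A : Type*} [AddCommGroup A] [Module ℂ A]
    (β : A →ₗ[ℂ] A →ₗ[ℂ] A) (hleib : IsLeibniz β)
    (hdim : Module.finrank ℂ A = 4)
    (hnonsplit : ¬ LeibIsSplit β)
    (hnonlie : leibSpan β ≠ ⊥)
    (hnilp : LeibNilpotent β)
    (hA2 : Module.finrank ℂ (lpow β 2) = 2)
    (hLeib : Module.finrank ℂ (leibSpan β) = 2)
    (hA3 : Module.finrank ℂ (lpow β 3) = 1) :
    LeibIso β (mkBil sA20) ∨ LeibIso β (mkBil sA21) ∨ LeibIso β (mkBil sA22) ∨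
      LeibIso β (mkBil sA23) ∨ LeibIso β (mkBil sA24) ∨ LeibIso β (mkBil sA25) := by
  obtain ⟨v, p, q, r, s, b, c, h, hpr⟩ := exists_reducedTable hleib hdim hnilp hA2 hLeib hA3
  by_cases hr : r = 0
  · subst hr
    have hp := hpr rfl
    by_cases hc : c = 0
    · subst hc
      by_cases hb : b = 0
      · subst hb
        exact absurd h.isSplit hnonsplit
      · have := h.leibIso_of_eq_zero hp (k := 0) (t := p / b) (ε := 1) (δ := 0)
          (div_ne_zero hp hb) (by field_simp; ring) (by ring)
        simp only [one_smul, zero_smul] at this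
        exact .inr (.inr (.inr (.inr (.inl this))))
    · obtain ⟨t, ht⟩ := IsAlgClosed.exists_pow_nat_eq (p / c) (n := 2) two_pos
      have ht0 : t ≠ 0 := by
        rintro rfl
        exact div_ne_zero hp hc (by simpa using ht.symm)
      have := h.leibIso_of_eq_zero hp (k := -(b / c)) (ε := 0) (δ := 1) ht0
        (by field_simp; ring) (by rw [ht]; field_simp)
      simp only [one_smul, zero_smul] at this
      exact .inr (.inr (.inr (.inr (.inr this))))
  · by_cases hB : b - p / r * c = 0 <;> by_cases hc : c = 0
    · have := h.leibIso_of_ne_zero hr (σ := 1) (t := 1) (ε := 0) (δ := 0) one_ne_zero one_ne_zero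
        (by rw [hB]; ring) (by rw [hc]; ring)
      have h20 : sA20 = ![![0, E 2, E 3, 0], ![(0 : ℂ) • E 3, (0 : ℂ) • E 3, 0, 0], 0, 0] := by
        ext i j k
        fin_cases i <;> fin_cases j <;> simp [sA20]
      exact .inl (h20 ▸ this)
    · have := h.leibIso_of_ne_zero hr (σ := 1) (t := r / c) (ε := 0) (δ := 1) one_ne_zero
        (div_ne_zero hr hc) (by rw [hB]; ring) (by field_simp)
      simp only [one_smul, zero_smul] at this
      exact .inr (.inl this)
    · have := h.leibIso_of_ne_zero hr (σ := (b - p / r * c) / r) (t := 1) (ε := 1) (δ := 0)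
        (div_ne_zero hB hr) one_ne_zero (by rw [one_mul, div_mul_cancel₀ _ hr]) (by rw [hc]; ring)
      simp only [one_smul, zero_smul] at this
      exact .inr (.inr (.inl this))
    · have hσ := div_ne_zero hB hr
      have := h.leibIso_of_ne_zero hr (σ := (b - p / r * c) / r)
        (t := ((b - p / r * c) / r) ^ 2 * r / c) (ε := 1) (δ := 1) hσ
        (div_ne_zero (mul_ne_zero (pow_ne_zero 2 hσ) hr) hc)
        (by rw [one_mul, div_mul_cancel₀ _ hr]) (by rw [div_mul_cancel₀ _ hc, one_mul])
      simp only [one_smul] at this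
      exact .inr (.inr (.inr (.inl this)))
end
end

section
/- If A is a nilpotent Leibniz algebra over ℂ with dim Leib(A) = 1, then Leib(A) ⊆ Z(A), i.e. every element of Leib(A) satisfies [x,a] = 0 = [a,x] for all a ∈ A. -/
noncomputable section

theorem square_mem_leibSpan {A : Type*} [AddCommGroup A] [Module ℂ A]
    (β : A →ₗ[ℂ] A →ₗ[ℂ] A) (a : A) : β a a ∈ leibSpan β :=
  Submodule.subset_span ⟨a, rfl⟩

theorem IsLeibniz.apply_eq_zero_of_mem_leibSpan {A : Type*} [AddCommGroup A] [Module ℂ A]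
    {β : A →ₗ[ℂ] A →ₗ[ℂ] A} (hβ : IsLeibniz β) {x : A} (hx : x ∈ leibSpan β) : β x = 0 := by
  have h : leibSpan β ≤ LinearMap.ker β := by
    refine Submodule.span_le.2 ?_
    rintro _ ⟨a, rfl⟩
    refine LinearMap.mem_ker.2 (LinearMap.ext fun c => ?_)
    simpa using hβ a a c
  exact LinearMap.mem_ker.1 (h hx)

theorem IsLeibniz.apply_mem_leibSpan {A : Type*} [AddCommGroup A] [Module ℂ A]
    {β : A →ₗ[ℂ] A →ₗ[ℂ] A} (hβ : IsLeibniz β) (a : A) {x : A} (hx : x ∈ leibSpan β) :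
    β a x ∈ leibSpan β := by
  have h : leibSpan β ≤ (leibSpan β).comap (β a) := by
    refine Submodule.span_le.2 ?_
    rintro _ ⟨b, rfl⟩
    have key : β a (β b b) = β (β a b + b) (β a b + b) - β (β a b) (β a b) - β b b := by
      rw [hβ a b b]
      simp only [map_add, LinearMap.add_apply]
      abel
    change β a (β b b) ∈ leibSpan β
    rw [key]
    exact sub_mem (sub_mem (square_mem_leibSpan β _) (square_mem_leibSpan β _))
      (square_mem_leibSpan β _)
  exact h hx

/-- An eigenvector of a left multiplication with nonzero eigenvalue lies in every term of the
lower central series. -/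
theorem mem_lpow_of_apply_eq_smul {A : Type*} [AddCommGroup A] [Module ℂ A]
    {β : A →ₗ[ℂ] A →ₗ[ℂ] A} {a x : A} {c : ℂ} (hc : c ≠ 0) (h : β a x = c • x) :
    ∀ n : ℕ, x ∈ lpow β n
  | 0 => Submodule.mem_top
  | 1 => Submodule.mem_top
  | n + 2 => Submodule.subset_span
      ⟨a, c⁻¹ • x, Submodule.smul_mem _ _ (mem_lpow_of_apply_eq_smul hc h (n + 1)), by
        rw [map_smul, h, inv_smul_smul₀ hc]⟩

/-- If `A` is a nilpotent Leibniz algebra with `dim Leib(A) = 1`, then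
`Leib(A) ⊆ Z(A)`. -/
theorem leib_subset_center_of_nilpotent_dim_one
    {A : Type*} [AddCommGroup A] [Module ℂ A]
    (β : A →ₗ[ℂ] A →ₗ[ℂ] A) (hleib : IsLeibniz β)
    (hnilp : LeibNilpotent β)
    (hLeib : Module.finrank ℂ (leibSpan β) = 1) :
    ∀ x ∈ leibSpan β, ∀ a : A, β x a = 0 ∧ β a x = 0 := by
  intro x hx a
  refine ⟨by rw [hleib.apply_eq_zero_of_mem_leibSpan hx, LinearMap.zero_apply], ?_⟩
  by_cases hx0 : x = 0
  · rw [hx0, map_zero]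
  obtain ⟨c, hc⟩ := (finrank_eq_one_iff_of_nonzero' (⟨x, hx⟩ : leibSpan β)
    (by simpa using hx0)).1 hLeib ⟨β a x, hleib.apply_mem_leibSpan a hx⟩
  have hax : β a x = c • x := (congrArg Subtype.val hc).symm
  by_cases hc0 : c = 0
  · rw [hax, hc0, zero_smul]
  obtain ⟨n, hn⟩ := hnilp
  have hmem := mem_lpow_of_apply_eq_smul hc0 hax n
  rw [hn, Submodule.mem_bot] at hmem
  exact absurd hmem hx0
end
end
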